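/- arXiv:2005.11571 — 14 statements merged into one kernel-verified Lean document; each statement's English description precedes it below -/
import Mathlib

section
/- The map ψ_H : T → T is additive and multiplicative: ψ_H(s + t) = ψ_H(s) + ψ_H(t) and ψ_H(s·t) = ψ_H(s)·ψ_H(t) for all s, t ∈ T (so ψ_H is a, possibly non-unital, ring homomorphism). -/
open Finset

variable {T : Type*} [CommRing T] {G : Type*} [Group G]

/-- The idempotents `e_i` associated to the enumeration `h` of the subgroup `H`:
`e_1 = 1_S` and `e_i = (1 - β_{h_1}(1_S))⋯(1 - β_{h_{i-1}}(1_S))·β_{h_i}(1_S)`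
(0-based indexing, with `h 0 = 1`). -/
def eIdem (β : G →* RingAut T) (oneS : T) {m : ℕ} (h : Fin (m + 1) → G)
    (i : Fin (m + 1)) : T :=
  (∏ j ∈ Finset.univ.filter (fun j => j < i), (1 - β (h j) oneS)) * β (h i) oneS

/-- The map `ψ_H : T → T`, `ψ_H(t) = Σ_i β_{h_i}(t)·e_i`. -/
def psiH (β : G →* RingAut T) (oneS : T) {m : ℕ} (h : Fin (m + 1) → G) (t : T) : T :=
  ∑ i : Fin (m + 1), β (h i) t * eIdem β oneS h i

theorem eIdem_sq {T : Type*} [CommRing T] {G : Type*} [Group G]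
    (β : G →* RingAut T) (oneS : T) (honeS : oneS * oneS = oneS) {m : ℕ}
    (h : Fin (m + 1) → G) (i : Fin (m + 1)) :
    eIdem β oneS h i * eIdem β oneS h i = eIdem β oneS h i := by
  have hb : ∀ g : G, β g oneS * β g oneS = β g oneS := fun g => by
    rw [← map_mul, honeS]
  unfold eIdem
  rw [mul_mul_mul_comm, hb, ← Finset.prod_mul_distrib]
  congr 1
  refine Finset.prod_congr rfl fun j _ => ?_
  linear_combination hb (h j)

theorem eIdem_orth_lt {T : Type*} [CommRing T] {G : Type*} [Group G]
    (β : G →* RingAut T) (oneS : T) (honeS : oneS * oneS = oneS) {m : ℕ}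
    (h : Fin (m + 1) → G) (i j : Fin (m + 1)) (hij : i < j) :
    eIdem β oneS h i * eIdem β oneS h j = 0 := by
  have hb : β (h i) oneS * β (h i) oneS = β (h i) oneS := by
    rw [← map_mul, honeS]
  have hmem : i ∈ Finset.univ.filter (fun k => k < j) := by simp [hij]
  unfold eIdem
  rw [← Finset.mul_prod_erase (Finset.univ.filter (fun k => k < j)) _ hmem]
  generalize (∏ k ∈ (Finset.univ.filter (fun k => k < j)).erase i, (1 - β (h k) oneS)) = P
  generalize (∏ k ∈ Finset.univ.filter (fun k => k < i), (1 - β (h k) oneS)) = Q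
  linear_combination (-(P * Q * β (h j) oneS)) * hb

theorem eIdem_orth {T : Type*} [CommRing T] {G : Type*} [Group G]
    (β : G →* RingAut T) (oneS : T) (honeS : oneS * oneS = oneS) {m : ℕ}
    (h : Fin (m + 1) → G) (i j : Fin (m + 1)) (hij : i ≠ j) :
    eIdem β oneS h i * eIdem β oneS h j = 0 := by
  rcases lt_or_gt_of_ne hij with hlt | hlt
  · exact eIdem_orth_lt β oneS honeS h i j hlt
  · rw [mul_comm]
    exact eIdem_orth_lt β oneS honeS h j i hlt

/-- `ψ_H` is additive and multiplicative. -/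
theorem psiH_add_mul {T : Type*} [CommRing T] {G : Type*} [Group G] [Fintype G]
    (β : G →* RingAut T) (oneS : T) (honeS : oneS * oneS = oneS)
    (H : Subgroup G) {m : ℕ} (h : Fin (m + 1) → G)
    (hinj : Function.Injective h) (hrange : Set.range h = (H : Set G))
    (h1 : h 0 = 1) :
    ∀ s t : T,
      psiH β oneS h (s + t) = psiH β oneS h s + psiH β oneS h t ∧
      psiH β oneS h (s * t) = psiH β oneS h s * psiH β oneS h t := by
  intro s t
  constructor
  · simp only [psiH, map_add, add_mul, Finset.sum_add_distrib]
  · simp only [psiH, map_mul]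
    rw [Finset.sum_mul_sum]
    refine Finset.sum_congr rfl fun i _ => ?_
    rw [Finset.sum_eq_single i]
    · linear_combination (-(β (h i) s * β (h i) t)) * eIdem_sq β oneS honeS h i
    · intro j _ hj
      linear_combination (β (h i) s * β (h j) t) * eIdem_orth β oneS honeS h i j hj.symm
    · intro hi
      exact absurd (Finset.mem_univ i) hi
end

section
/- One has e_H ∈ T^H and ψ_H(S^{α_H}) = T^H·e_H; moreover the restriction of ψ_H to S^{α_H} is a ring isomorphism from S^{α_H} onto T^H·e_H whose inverse is multiplication by 1_S (x ↦ x·1_S). In particular T^H·1_S = S^{α_H}. -/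
open Finset

variable {T : Type*} [CommRing T] {G : Type*} [Group G]

/-- The fixed subring `T^H = {t ∈ T : β_h(t) = t for all h ∈ H}`. -/
def TFix (β : G →* RingAut T) (H : Subgroup G) : Set T :=
  {t : T | ∀ g ∈ H, β g t = t}

/-- The invariants `S^{α_H} = {s ∈ S : β_h(s)·1_S = s·1_h for all h ∈ H}`,
where `1_h = β_h(1_S)·1_S`. -/
def SinvH (β : G →* RingAut T) (oneS : T) (H : Subgroup G) : Set T :=
  {s : T | s * oneS = s ∧ ∀ g ∈ H, β g s * oneS = s * (β g oneS * oneS)}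

/-- `e_H ∈ T^H`, `ψ_H(S^{α_H}) = T^H·e_H`, and the restriction of `ψ_H`
to `S^{α_H}` is a ring isomorphism onto `T^H·e_H` with inverse the multiplication
by `1_S`; in particular `T^H·1_S = S^{α_H}`. -/
theorem psiH_iso_on_invariants {T : Type*} [CommRing T] {G : Type*} [Group G] [Fintype G]
    (β : G →* RingAut T) (oneS : T) (honeS : oneS * oneS = oneS)
    (H : Subgroup G) {m : ℕ} (h : Fin (m + 1) → G)
    (hinj : Function.Injective h) (hrange : Set.range h = (H : Set G))
    (h1 : h 0 = 1) :
    psiH β oneS h oneS ∈ TFix β H ∧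
    psiH β oneS h '' SinvH β oneS H = (fun t => t * psiH β oneS h oneS) '' TFix β H ∧
    (∀ s ∈ SinvH β oneS H, psiH β oneS h s * oneS = s) ∧
    (∀ t ∈ TFix β H, psiH β oneS h (t * psiH β oneS h oneS * oneS) =
      t * psiH β oneS h oneS) ∧
    (fun t => t * oneS) '' TFix β H = SinvH β oneS H := by
  have hu : ∀ g, β g oneS * β g oneS = β g oneS := fun g => by rw [← map_mul, honeS]
  have hmem : ∀ i, h i ∈ H := fun i => by
    have : h i ∈ Set.range h := ⟨i, rfl⟩
    rw [hrange] at this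
    exact this
  have hsur : ∀ g ∈ H, ∃ i, h i = g := fun g hg => by
    have : g ∈ Set.range h := by rw [hrange]; exact hg
    exact this
  have hβ : ∀ a b x, β a (β b x) = β (a * b) x := fun a b x => by
    rw [map_mul]; rfl
  have hβ1 : ∀ x, β 1 x = x := fun x => by rw [map_one]; rfl
  have hue : ∀ i, β (h i) oneS * eIdem β oneS h i = eIdem β oneS h i := fun i => by
    unfold eIdem
    linear_combination (∏ j ∈ Finset.univ.filter (fun j => j < i), (1 - β (h j) oneS)) * hu (h i)
  have hsum : psiH β oneS h oneS = ∑ i, eIdem β oneS h i := by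
    unfold psiH
    exact Finset.sum_congr rfl fun i _ => hue i
  have hprod : psiH β oneS h oneS = 1 - ∏ i, (1 - β (h i) oneS) := by
    rw [hsum, Finset.prod_one_sub_ordered]
    simp only [eIdem, sub_sub_cancel]
    exact Finset.sum_congr rfl fun i _ => mul_comm _ _
  have hke : ∀ k, β (h k) oneS * psiH β oneS h oneS = β (h k) oneS := fun k => by
    rw [hprod, ← Finset.mul_prod_erase _ _ (Finset.mem_univ k)]
    linear_combination (∏ i ∈ Finset.univ.erase k, (1 - β (h i) oneS)) * hu (h k)
  have hee : ∀ k, eIdem β oneS h k * psiH β oneS h oneS = eIdem β oneS h k := fun k => by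
    rw [← hue k]
    linear_combination eIdem β oneS h k * hke k
  have heH : psiH β oneS h oneS * psiH β oneS h oneS = psiH β oneS h oneS := by
    nth_rw 1 [hsum]
    rw [Finset.sum_mul, Finset.sum_congr rfl fun i _ => hee i, ← hsum]
  have hperm : ∀ g ∈ H, ∃ σ : Equiv.Perm (Fin (m + 1)), ∀ i, h (σ i) = g * h i := by
    intro g hg
    choose f hf using fun i => hsur (g * h i) (H.mul_mem hg (hmem i))
    have hfi : Function.Injective f := fun i j hij => by
      have := hf i
      rw [hij, hf j] at this
      exact (hinj (mul_left_cancel this)).symm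
    exact ⟨Equiv.ofBijective f (Finite.injective_iff_bijective.mp hfi), hf⟩
  have hfix : ∀ g ∈ H, β g (psiH β oneS h oneS) = psiH β oneS h oneS := by
    intro g hg
    obtain ⟨σ, hσ⟩ := hperm g hg
    rw [hprod, map_sub, map_one, map_prod]
    congr 1
    rw [← Equiv.prod_comp σ (fun i => 1 - β (h i) oneS)]
    refine Finset.prod_congr rfl fun i _ => ?_
    rw [map_sub, map_one, hβ, hσ]
  have hext : ∀ x y, x * psiH β oneS h oneS = x → y * psiH β oneS h oneS = y →
      (∀ k, x * β (h k) oneS = y * β (h k) oneS) → x = y := by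
    intro x y hx hy hxy
    rw [← hx, ← hy, hsum, Finset.mul_sum, Finset.mul_sum]
    refine Finset.sum_congr rfl fun i _ => ?_
    rw [← hue i]
    linear_combination eIdem β oneS h i * hxy i
  have hpe : ∀ t, psiH β oneS h t * psiH β oneS h oneS = psiH β oneS h t := by
    intro t
    conv_lhs => rw [psiH.eq_def β oneS h t]
    conv_rhs => rw [psiH.eq_def β oneS h t]
    rw [Finset.sum_mul]
    exact Finset.sum_congr rfl fun i _ => by rw [mul_assoc, hee]
  have hkey : ∀ s ∈ SinvH β oneS H, ∀ k, psiH β oneS h s * β (h k) oneS = β (h k) s := by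
    rintro s ⟨hs, hs'⟩ k
    have hsk : β (h k) s * β (h k) oneS = β (h k) s := by rw [← map_mul, hs]
    have h3 : ∀ i, β (h i) s * β (h k) oneS = β (h k) s * β (h i) oneS := by
      intro i
      have := congrArg (β (h k)) (hs' ((h k)⁻¹ * h i) (H.mul_mem (H.inv_mem (hmem k)) (hmem i)))
      rw [map_mul (β (h k)), map_mul (β (h k)), map_mul (β (h k)), hβ, hβ,
        mul_inv_cancel_left] at this
      linear_combination this + β (h i) oneS * hsk
    have h4 : psiH β oneS h s * β (h k) oneS = β (h k) s * psiH β oneS h oneS := by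
      unfold psiH
      rw [Finset.sum_mul, Finset.mul_sum]
      refine Finset.sum_congr rfl fun i _ => ?_
      linear_combination eIdem β oneS h i * h3 i
    rw [h4]
    linear_combination β (h k) s * hke k + (1 - psiH β oneS h oneS) * hsk
  have hpfix : ∀ s ∈ SinvH β oneS H, psiH β oneS h s ∈ TFix β H := by
    intro s hs g hg
    refine hext _ _ ?_ (hpe s) fun k => ?_
    · nth_rw 1 [← hfix g hg]
      rw [← map_mul, hpe]
    · obtain ⟨i, hi⟩ := hsur (g⁻¹ * h k) (H.mul_mem (H.inv_mem hg) (hmem k))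
      have := congrArg (β g) (hkey s hs i)
      rw [map_mul, hβ, hβ, hi, mul_inv_cancel_left] at this
      rw [this, hkey s hs k]
  have hS : ∀ t ∈ TFix β H, t * oneS ∈ SinvH β oneS H := by
    intro t ht
    refine ⟨by rw [mul_assoc, honeS], fun g hg => ?_⟩
    rw [map_mul, ht g hg]
    linear_combination -t * β g oneS * honeS
  have hC : ∀ s ∈ SinvH β oneS H, psiH β oneS h s * oneS = s := by
    intro s hs
    have := hkey s hs 0
    rwa [h1, hβ1, hβ1] at this
  have hD : ∀ t ∈ TFix β H, psiH β oneS h (t * psiH β oneS h oneS * oneS) =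
      t * psiH β oneS h oneS := by
    intro t ht
    have : psiH β oneS h (t * psiH β oneS h oneS * oneS) =
        t * psiH β oneS h oneS * psiH β oneS h oneS := by
      have h5 : ∀ i, β (h i) (t * psiH β oneS h oneS * oneS) =
          t * psiH β oneS h oneS * β (h i) oneS := fun i => by
        rw [map_mul, map_mul, ht _ (hmem i), hfix _ (hmem i)]
      generalize t * psiH β oneS h oneS = y at h5 ⊢
      unfold psiH
      rw [Finset.mul_sum]
      exact Finset.sum_congr rfl fun i _ => by rw [h5, mul_assoc]
    rw [this, mul_assoc, heH]
  refine ⟨hfix, ?_, hC, hD, ?_⟩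
  · ext x
    constructor
    · rintro ⟨s, hs, rfl⟩
      exact ⟨_, hpfix s hs, hpe s⟩
    · rintro ⟨t, ht, rfl⟩
      refine ⟨_, hS (t * psiH β oneS h oneS) fun g hg => ?_, hD t ht⟩
      rw [map_mul, ht g hg, hfix g hg]
  · ext x
    constructor
    · rintro ⟨t, ht, rfl⟩
      exact hS t ht
    · intro hx
      exact ⟨_, hpfix x hx, hC x hx⟩
end

section
/- Assume H is normal in G and let g_1 = 1, g_2, …, g_l be a complete set of representatives of the cosets of H in G. Then T^H = Σ_{i=1}^{l} β_{g_i}(T^H·e_H), i.e. every element of T^H is a finite sum of elements of the sets β_{g_i}(T^H·e_H). Consequently the induced global action of G/H on T^H (given by gH ↦ β_g|_{T^H}) is a globalization of the partial action of G/H on the ideal T^H·e_H obtained by restriction. -/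
open Finset

variable {T : Type*} [CommRing T] {G : Type*} [Group G]

theorem sum_ordered_aux {T : Type*} [CommRing T] {n : ℕ} (f : Fin n → T) :
    ∑ i, (∏ j ∈ Finset.univ.filter (fun j => j < i), (1 - f j)) * f i
      = 1 - ∏ i, (1 - f i) := by
  rw [Finset.prod_one_sub_ordered]
  simp [mul_comm]

theorem psiH_aux {T : Type*} [CommRing T] {G : Type*} [Group G]
    (β : G →* RingAut T) (oneS : T) (honeS : oneS * oneS = oneS) {m : ℕ}
    (h : Fin (m + 1) → G) :
    psiH β oneS h oneS = 1 - ∏ i, (1 - β (h i) oneS) := by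
  rw [← sum_ordered_aux]
  unfold psiH eIdem
  refine Finset.sum_congr rfl fun i _ => ?_
  have : β (h i) oneS * β (h i) oneS = β (h i) oneS := by rw [← map_mul, honeS]
  rw [mul_left_comm, this]

theorem TFix_stable_aux {T : Type*} [CommRing T] {G : Type*} [Group G]
    (β : G →* RingAut T) (H : Subgroup G) (hN : H.Normal) (g : G) (t : T)
    (ht : t ∈ TFix β H) : β g t ∈ TFix β H := by
  intro k hk
  have h2 := ht (g⁻¹ * k * g) (by simpa using hN.conj_mem k hk g⁻¹)
  calc β k (β g t) = β (g * (g⁻¹ * k * g)) t := by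
        rw [show g * (g⁻¹ * k * g) = k * g by group, map_mul]; rfl
    _ = β g (β (g⁻¹ * k * g) t) := by rw [map_mul]; rfl
    _ = β g t := by rw [h2]

theorem psiH_fix_aux {T : Type*} [CommRing T] {G : Type*} [Group G]
    (β : G →* RingAut T) (oneS : T) (honeS : oneS * oneS = oneS)
    (H : Subgroup G) {m : ℕ} (h : Fin (m + 1) → G)
    (hinj : Function.Injective h) (hrange : Set.range h = (H : Set G)) :
    psiH β oneS h oneS ∈ TFix β H := by
  intro k hk
  have hmem : ∀ i, h i ∈ H := fun i => by
    have : h i ∈ Set.range h := ⟨i, rfl⟩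
    rw [hrange] at this; exact this
  let e : Fin (m + 1) ≃ H := Equiv.ofBijective (fun i => ⟨h i, hmem i⟩)
    ⟨fun a b hab => hinj (by simpa using hab), fun x => by
      have : (x : G) ∈ Set.range h := by rw [hrange]; exact x.2
      obtain ⟨i, hi⟩ := this
      exact ⟨i, Subtype.ext hi⟩⟩
  have he : ∀ i, ((e i : H) : G) = h i := fun i => rfl
  let p : Fin (m + 1) ≃ Fin (m + 1) := (e.trans (Equiv.mulLeft ⟨k, hk⟩)).trans e.symm
  have hp : ∀ i, h (p i) = k * h i := fun i => by
    rw [← he]; simp [p, he]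
  rw [psiH_aux β oneS honeS, map_sub, map_one, map_prod]
  congr 1
  rw [← Equiv.prod_comp p (fun i => 1 - β (h i) oneS)]
  refine Finset.prod_congr rfl fun i _ => ?_
  rw [hp, map_mul, map_sub, map_one]; rfl

/-- if `H` is normal in `G` and `g_1 = 1, g_2, …, g_l` is a complete set of
representatives of the cosets of `H` in `G`, then `T^H = Σ_{i=1}^{l} β_{g_i}(T^H·e_H)`;
this expresses that the induced global `G/H`-action on `T^H` is a globalization of the
partial `G/H`-action on the ideal `T^H·e_H`. -/
theorem TFix_eq_sum_translates {T : Type*} [CommRing T] {G : Type*} [Group G] [Fintype G]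
    (β : G →* RingAut T) (oneS : T) (honeS : oneS * oneS = oneS)
    (hglob : ∀ t : T, ∃ c : G → T, t = ∑ g : G, β g (c g * oneS))
    (H : Subgroup G) (hN : H.Normal) {m : ℕ} (h : Fin (m + 1) → G)
    (hinj : Function.Injective h) (hrange : Set.range h = (H : Set G))
    (h1 : h 0 = 1)
    {l : ℕ} (gs : Fin (l + 1) → G) (hg1 : gs 0 = 1)
    (hgs : Function.Bijective (fun i : Fin (l + 1) => (QuotientGroup.mk (gs i) : G ⧸ H))) :
    ∀ t ∈ TFix β H, ∃ c : Fin (l + 1) → T, (∀ i, c i ∈ TFix β H) ∧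
      t = ∑ i : Fin (l + 1), β (gs i) (c i * psiH β oneS h oneS) := by
  intro t ht
  set e := psiH β oneS h oneS with he
  have hefix : e ∈ TFix β H := psiH_fix_aux β oneS honeS H h hinj hrange
  have hinv : ∀ (g : G) (x : T), β g (β g⁻¹ x) = x := fun g x => by
    have : β (g * g⁻¹) x = x := by rw [mul_inv_cancel, map_one]; rfl
    rw [map_mul] at this; exact this
  have hkill : ∀ x ∈ H, β x oneS * (1 - e) = 0 := by
    intro x hx
    have hx' : x ∈ Set.range h := by rw [hrange]; exact hx
    obtain ⟨i, rfl⟩ := hx'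
    rw [he, psiH_aux β oneS honeS, sub_sub_cancel,
      ← Finset.mul_prod_erase Finset.univ _ (Finset.mem_univ i), ← mul_assoc, mul_sub,
      ← map_mul, honeS, mul_one, sub_self, zero_mul]
  have hkillG : ∀ g : G, β g oneS * ∏ i, (1 - β (gs i) e) = 0 := by
    intro g
    obtain ⟨i, hi⟩ := hgs.2 (QuotientGroup.mk g)
    have hmem : (gs i)⁻¹ * g ∈ H := QuotientGroup.eq.1 hi
    have h3 : β g oneS * (1 - β (gs i) e) = 0 := by
      have h4 : β g oneS = β (gs i) (β ((gs i)⁻¹ * g) oneS) := by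
        conv_lhs => rw [← mul_inv_cancel_left (gs i) g, map_mul]
        rfl
      rw [h4, ← map_one (β (gs i)), ← map_sub, ← map_mul, hkill _ hmem, map_zero]
    rw [← Finset.mul_prod_erase Finset.univ _ (Finset.mem_univ i), ← mul_assoc, h3, zero_mul]
  have hprod : ∏ i, (1 - β (gs i) e) = 0 := by
    generalize ∏ i, (1 - β (gs i) e) = P at hkillG
    obtain ⟨c, hc⟩ := hglob 1
    rw [← one_mul P, hc, Finset.sum_mul]
    refine Finset.sum_eq_zero fun g _ => ?_
    rw [map_mul, mul_assoc, hkillG, mul_zero]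
  have hmulfix : ∀ x ∈ TFix β H, ∀ y ∈ TFix β H, x * y ∈ TFix β H := by
    intro x hx y hy k hk
    rw [map_mul, hx k hk, hy k hk]
  refine ⟨fun i => β (gs i)⁻¹
    (t * ∏ j ∈ Finset.univ.filter (fun j => j < i), (1 - β (gs j) e)), ?_, ?_⟩
  · intro i
    refine TFix_stable_aux β H hN _ _ (hmulfix _ ht _ ?_)
    intro k hk
    rw [map_prod]
    refine Finset.prod_congr rfl fun j _ => ?_
    rw [map_sub, map_one, TFix_stable_aux β H hN (gs j) e hefix k hk]
  · have h5 := sum_ordered_aux (fun i => β (gs i) e)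
    rw [hprod, sub_zero] at h5
    conv_lhs => rw [← mul_one t, ← h5, Finset.mul_sum]
    refine Finset.sum_congr rfl fun i _ => ?_
    rw [map_mul, hinv, mul_assoc]
end

section
/- Assume H is normal in G. Then: (a) each 1̃_{gH} = β_g(e_H)·1_S is an idempotent lying in S^{α_H} and depends only on the coset gH; (b) each α_{gH} is a well-defined ring isomorphism from D̃_{g⁻¹H} onto D̃_{gH} depending only on the coset gH; and (c) the family α_{G/H} = (D̃_{gH}, α_{gH})_{gH ∈ G/H} is a unital partial action of the quotient group G/H on S^{α_H}: α_{1H} is the identity of S^{α_H}, α_{gH}(D̃_{g⁻¹H} ∩ D̃_{lH}) = D̃_{gH} ∩ D̃_{glH} for all g, l ∈ G, and α_{gH}(α_{lH}(x)) = α_{glH}(x) for all x ∈ D̃_{l⁻¹H} ∩ D̃_{(gl)⁻¹H}. -/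
open Finset

variable {T : Type*} [CommRing T] {G : Type*} [Group G]

/-- The idempotent `1̃_{gH} = β_g(e_H)·1_S` of `S^{α_H}`. -/
def tilde1 (β : G →* RingAut T) (oneS : T) {m : ℕ} (h : Fin (m + 1) → G) (g : G) : T :=
  β g (psiH β oneS h oneS) * oneS

/-- The ideal `D̃_{gH} = S^{α_H}·1̃_{gH}` of `S^{α_H}`. -/
def DtH (β : G →* RingAut T) (oneS : T) (H : Subgroup G) {m : ℕ}
    (h : Fin (m + 1) → G) (g : G) : Set T :=
  (fun s => s * tilde1 β oneS h g) '' SinvH β oneS H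

/-- The map `α_{gH} : D̃_{g⁻¹H} → D̃_{gH}`, `α_{gH}(x) = β_g(ψ_H(x))·1_S`. -/
def aMapH (β : G →* RingAut T) (oneS : T) {m : ℕ} (h : Fin (m + 1) → G)
    (g : G) (x : T) : T :=
  β g (psiH β oneS h x) * oneS

lemma aux_mul_e {T : Type*} [CommRing T] {G : Type*} [Group G]
    (β : G →* RingAut T) (oneS : T) {m : ℕ} (h : Fin (m + 1) → G) (k : Fin (m + 1))
    (honeS : oneS * oneS = oneS) :
    β (h k) oneS * ∑ i, eIdem β oneS h i = β (h k) oneS := by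
  have h2 := Finset.prod_one_sub_ordered (Finset.univ : Finset (Fin (m+1)))
    (fun i => β (h i) oneS)
  have h3 : ∑ i, eIdem β oneS h i = 1 - ∏ i, (1 - β (h i) oneS) := by
    rw [h2, sub_sub_cancel]
    exact Finset.sum_congr rfl fun i _ => by rw [eIdem, mul_comm]
  have hid : β (h k) oneS * β (h k) oneS = β (h k) oneS := by rw [← map_mul, honeS]
  rw [h3, ← Finset.mul_prod_erase _ _ (Finset.mem_univ k)]
  linear_combination (∏ x ∈ univ.erase k, (1 - β (h x) oneS)) * hid

lemma aux_eIdem {T : Type*} [CommRing T] {G : Type*} [Group G]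
    (β : G →* RingAut T) (oneS : T) {m : ℕ} (h : Fin (m + 1) → G) (i : Fin (m + 1))
    (honeS : oneS * oneS = oneS) :
    β (h i) oneS * eIdem β oneS h i = eIdem β oneS h i := by
  have hid : β (h i) oneS * β (h i) oneS = β (h i) oneS := by rw [← map_mul, honeS]
  rw [eIdem]
  linear_combination (∏ j ∈ Finset.univ.filter (fun j => j < i), (1 - β (h j) oneS)) * hid

lemma aux_psi_one {T : Type*} [CommRing T] {G : Type*} [Group G]
    (β : G →* RingAut T) (oneS : T) {m : ℕ} (h : Fin (m + 1) → G)
    (honeS : oneS * oneS = oneS) :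
    psiH β oneS h oneS = ∑ i, eIdem β oneS h i :=
  Finset.sum_congr rfl fun i _ => aux_eIdem β oneS h i honeS

lemma aux_A {T : Type*} [CommRing T] {G : Type*} [Group G]
    (β : G →* RingAut T) (oneS : T) (H : Subgroup G)
    {m : ℕ} (h : Fin (m + 1) → G) (hH : ∀ i, h i ∈ H) (t : T) (ht : t ∈ TFix β H) :
    psiH β oneS h (t * oneS) = t * psiH β oneS h oneS := by
  rw [psiH, psiH, Finset.mul_sum]
  refine Finset.sum_congr rfl fun i _ => ?_
  rw [map_mul, ht _ (hH i), mul_assoc]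

lemma aux_C {T : Type*} [CommRing T] {G : Type*} [Group G]
    (β : G →* RingAut T) (oneS : T) (honeS : oneS * oneS = oneS) (H : Subgroup G)
    (t : T) (ht : t ∈ TFix β H) : t * oneS ∈ SinvH β oneS H := by
  refine ⟨by rw [mul_assoc, honeS], fun g hg => ?_⟩
  rw [map_mul, ht g hg]
  linear_combination (-t * β g oneS) * honeS

lemma aux_key {T : Type*} [CommRing T] {G : Type*} [Group G]
    (β : G →* RingAut T) (oneS : T) (honeS : oneS * oneS = oneS) (H : Subgroup G)
    {m : ℕ} (h : Fin (m + 1) → G) (hH : ∀ i, h i ∈ H) (hs : ∀ k ∈ H, ∃ i, h i = k)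
    (s : T) (hS : s ∈ SinvH β oneS H) (k : G) (hk : k ∈ H) :
    β k oneS * psiH β oneS h s = β k s := by
  obtain ⟨j, rfl⟩ := hs k hk
  have h4 : β (h j) s * ∑ i, eIdem β oneS h i = β (h j) s := by
    rw [← hS.1, map_mul, mul_assoc, aux_mul_e β oneS h j honeS]
  rw [← h4, psiH, Finset.mul_sum, Finset.mul_sum]
  refine Finset.sum_congr rfl fun i _ => ?_
  have h5 := hS.2 ((h j)⁻¹ * h i) (H.mul_mem (H.inv_mem (hH j)) (hH i))
  have h6 := congrArg (β (h j)) h5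
  have h7 : ∀ x, β (h j) (β ((h j)⁻¹ * h i) x) = β (h i) x := fun x => by
    rw [← RingAut.mul_apply, ← map_mul, mul_inv_cancel_left]
  have h8 : β (h j) s * β (h j) oneS = β (h j) s := by rw [← map_mul, hS.1]
  rw [map_mul (β (h j)), map_mul (β (h j)), map_mul (β (h j))] at h6
  rw [h7, h7] at h6
  linear_combination (eIdem β oneS h i) * h6 + β (h i) oneS * eIdem β oneS h i * h8 + β (h j) s * aux_eIdem β oneS h i honeS

lemma aux_B {T : Type*} [CommRing T] {G : Type*} [Group G]
    (β : G →* RingAut T) (oneS : T) (honeS : oneS * oneS = oneS) (H : Subgroup G)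
    {m : ℕ} (h : Fin (m + 1) → G) (hH : ∀ i, h i ∈ H) (hs : ∀ k ∈ H, ∃ i, h i = k)
    (s : T) (hS : s ∈ SinvH β oneS H) :
    psiH β oneS h s ∈ TFix β H ∧ psiH β oneS h s * psiH β oneS h oneS = psiH β oneS h s ∧
      psiH β oneS h s * oneS = s := by
  have key := aux_key β oneS honeS H h hH hs s hS
  have hle : ∀ l ∈ H, β l (psiH β oneS h s) * (∑ i, eIdem β oneS h i)
      = β l (psiH β oneS h s) := by
    intro l hl
    rw [psiH, map_sum, Finset.sum_mul]
    refine Finset.sum_congr rfl fun i _ => ?_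
    obtain ⟨j, hj⟩ := hs (l * h i) (H.mul_mem hl (hH i))
    have h3 := aux_mul_e β oneS h j honeS
    have h4 : β l (β (h i) oneS) = β (h j) oneS := by
      rw [← RingAut.mul_apply, ← map_mul, hj]
    have h5 := congrArg (β l) (aux_eIdem β oneS h i honeS)
    rw [map_mul, h4] at h5
    rw [map_mul]
    linear_combination (β l (β (h i) s)) * (β l (eIdem β oneS h i)) * h3
      + (1 - ∑ i, eIdem β oneS h i) * (β l (β (h i) s)) * h5
  have h1e : psiH β oneS h s * (∑ i, eIdem β oneS h i) = psiH β oneS h s := by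
    have := hle 1 H.one_mem
    simpa using this
  refine ⟨fun l hl => ?_, ?_, ?_⟩
  · rw [← hle l hl]
    conv_rhs => rw [← h1e]
    rw [Finset.mul_sum, Finset.mul_sum]
    refine Finset.sum_congr rfl fun i _ => ?_
    have h2 := congrArg (β l) (key (l⁻¹ * h i) (H.mul_mem (H.inv_mem hl) (hH i)))
    have h7 : ∀ x, β l (β (l⁻¹ * h i) x) = β (h i) x := fun x => by
      rw [← RingAut.mul_apply, ← map_mul, mul_inv_cancel_left]
    rw [map_mul (β l), h7, h7, ← key (h i) (hH i)] at h2
    rw [← aux_eIdem β oneS h i honeS]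
    linear_combination (eIdem β oneS h i) * h2
  · rw [aux_psi_one β oneS h honeS, h1e]
  · have := key 1 H.one_mem
    rw [mul_comm]
    simpa using this

/-- for `H` normal in `G`, the data `(D̃_{gH}, α_{gH})` form a unital partial
action `α_{G/H}` of the quotient group `G/H` on `S^{α_H}`: (a) each `1̃_{gH}` is an
idempotent of `S^{α_H}` depending only on the coset `gH`; (b) each `α_{gH}` is a
well-defined ring isomorphism of `D̃_{g⁻¹H}` onto `D̃_{gH}` depending only on the coset
`gH`; (c) `α_{1H} = id`, `α_{gH}(D̃_{g⁻¹H} ∩ D̃_{lH}) = D̃_{gH} ∩ D̃_{glH}`, and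
`α_{gH} ∘ α_{lH} = α_{glH}` on `D̃_{l⁻¹H} ∩ D̃_{(gl)⁻¹H}`. -/
theorem quotient_partial_action {T : Type*} [CommRing T] {G : Type*} [Group G] [Fintype G]
    (β : G →* RingAut T) (oneS : T) (honeS : oneS * oneS = oneS)
    (H : Subgroup G) (hN : H.Normal) {m : ℕ} (h : Fin (m + 1) → G)
    (hinj : Function.Injective h) (hrange : Set.range h = (H : Set G))
    (h1 : h 0 = 1) :
    -- (a)
    (∀ g : G, tilde1 β oneS h g * tilde1 β oneS h g = tilde1 β oneS h g ∧
      tilde1 β oneS h g ∈ SinvH β oneS H) ∧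
    (∀ g g' : G, g⁻¹ * g' ∈ H → tilde1 β oneS h g = tilde1 β oneS h g') ∧
    -- (b)
    (∀ g : G, Set.BijOn (aMapH β oneS h g) (DtH β oneS H h g⁻¹) (DtH β oneS H h g)) ∧
    (∀ g : G, ∀ x ∈ DtH β oneS H h g⁻¹, ∀ y ∈ DtH β oneS H h g⁻¹,
      aMapH β oneS h g (x + y) = aMapH β oneS h g x + aMapH β oneS h g y ∧
      aMapH β oneS h g (x * y) = aMapH β oneS h g x * aMapH β oneS h g y) ∧
    (∀ g g' : G, g⁻¹ * g' ∈ H →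
      Set.EqOn (aMapH β oneS h g) (aMapH β oneS h g') (DtH β oneS H h g⁻¹)) ∧
    -- (c)
    (∀ s ∈ SinvH β oneS H, aMapH β oneS h 1 s = s) ∧
    (∀ g l : G, aMapH β oneS h g '' (DtH β oneS H h g⁻¹ ∩ DtH β oneS H h l) =
      DtH β oneS H h g ∩ DtH β oneS H h (g * l)) ∧
    (∀ g l : G, ∀ x ∈ DtH β oneS H h l⁻¹ ∩ DtH β oneS H h (g * l)⁻¹,
      aMapH β oneS h g (aMapH β oneS h l x) = aMapH β oneS h (g * l) x) := by
  have hH : ∀ i, h i ∈ H := fun i => by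
    have : h i ∈ Set.range h := ⟨i, rfl⟩
    rw [hrange] at this
    exact this
  have hs : ∀ k ∈ H, ∃ i, h i = k := fun k hk => by
    have : k ∈ Set.range h := by rw [hrange]; exact hk
    exact this
  have hA := aux_A β oneS H h hH
  have hB := aux_B β oneS honeS H h hH hs
  have hC := aux_C β oneS honeS H
  have hone : oneS ∈ SinvH β oneS H := by
    have := hC 1 (fun g _ => map_one _)
    simpa using this
  obtain ⟨heF, hee, he1⟩ := hB oneS hone
  have haM : ∀ g, aMapH β oneS h g = fun x => β g (psiH β oneS h x) * oneS := fun _ => rfl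
  simp only [tilde1, haM, DtH]
  clear haM
  have hadd : ∀ x y, psiH β oneS h (x + y) = psiH β oneS h x + psiH β oneS h y := by
    intro x y
    simp only [psiH, map_add, add_mul, Finset.sum_add_distrib]
  generalize psiH β oneS h oneS = e at *
  generalize psiH β oneS h = ψ at *
  have hFm : ∀ x ∈ TFix β H, ∀ y ∈ TFix β H, x * y ∈ TFix β H := fun x hx y hy g hg => by
    rw [map_mul, hx g hg, hy g hg]
  have bm : ∀ g l x, β g (β l x) = β (g * l) x := fun g l x => by
    rw [map_mul, RingAut.mul_apply]
  have b1 : ∀ x, β 1 x = x := fun x => by simp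
  have hFg : ∀ g : G, ∀ x ∈ TFix β H, β g x ∈ TFix β H := fun g x hx k hk => by
    rw [bm, show k * g = g * (g⁻¹ * k * g) by group, ← bm,
      hx _ (by simpa using hN.conj_mem k hk g⁻¹)]
  have hFc : ∀ g g' : G, g⁻¹ * g' ∈ H → ∀ x ∈ TFix β H, β g x = β g' x := fun g g' hg x hx => by
    rw [show g' = g * (g⁻¹ * g') by group, ← bm, hx _ hg]
  have hgee : ∀ g, β g e * β g e = β g e := fun g => by rw [← map_mul, hee]
  -- description of the domains
  have hD : ∀ g x, x ∈ (fun s => s * (β g e * oneS)) '' SinvH β oneS H ↔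
      ∃ t ∈ TFix β H, t * e = t ∧ t * β g e = t ∧ t * oneS = x := by
    intro g x
    constructor
    · rintro ⟨s, hS, rfl⟩
      obtain ⟨a, b, c⟩ := hB s hS
      refine ⟨ψ s * β g e, hFm _ a _ (hFg g e heF), ?_, ?_, ?_⟩
      · linear_combination (β g e) * b
      · linear_combination ψ s * hgee g
      · linear_combination (β g e) * c - (β g e) * hS.1
    · rintro ⟨t, ht, a, b, rfl⟩
      refine ⟨t * oneS, hC t ht, ?_⟩
      linear_combination (t * β g e) * honeS + oneS * b
  have hψ : ∀ t ∈ TFix β H, t * e = t → ψ (t * oneS) = t := fun t ht hte => by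
    rw [hA t ht, hte]
  have gi : ∀ g x, β g (β g⁻¹ x) = x := fun g x => by rw [bm, mul_inv_cancel, b1]
  have gi' : ∀ g x, β g⁻¹ (β g x) = x := fun g x => by rw [bm, inv_mul_cancel, b1]
  have himg : ∀ g l : G, (fun x => β g (ψ x) * oneS) ''
      ((fun s => s * (β g⁻¹ e * oneS)) '' SinvH β oneS H ∩
        (fun s => s * (β l e * oneS)) '' SinvH β oneS H) =
      (fun s => s * (β g e * oneS)) '' SinvH β oneS H ∩
        (fun s => s * (β (g * l) e * oneS)) '' SinvH β oneS H := by
    intro g l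
    ext y
    constructor
    · rintro ⟨x, ⟨hx1, hx2⟩, rfl⟩
      obtain ⟨t, ht, a, b, rfl⟩ := (hD _ _).1 hx1
      obtain ⟨t', ht', a', b', c'⟩ := (hD _ _).1 hx2
      have htt : t' = t := by rw [← hψ t ht a, ← hψ t' ht' a', c']
      subst htt
      simp only [hψ _ ht a]
      have e1 := congrArg (β g) a
      have e2 := congrArg (β g) b
      have e3 := congrArg (β g) b'
      rw [map_mul] at e1 e2 e3
      rw [gi] at e2
      rw [bm] at e3
      exact ⟨(hD _ _).2 ⟨_, hFg g _ ht, e2, e1, rfl⟩, (hD _ _).2 ⟨_, hFg g _ ht, e2, e3, rfl⟩⟩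
    · rintro ⟨hx1, hx2⟩
      obtain ⟨t, ht, a, b, rfl⟩ := (hD _ _).1 hx1
      obtain ⟨t', ht', a', b', c'⟩ := (hD _ _).1 hx2
      have htt : t' = t := by rw [← hψ t ht a, ← hψ t' ht' a', c']
      subst htt
      have e1 := congrArg (β g⁻¹) a
      have e2 := congrArg (β g⁻¹) b
      have e3 := congrArg (β g⁻¹) b'
      rw [map_mul] at e1 e2 e3
      rw [gi'] at e2
      rw [bm, inv_mul_cancel_left] at e3
      refine ⟨β g⁻¹ t' * oneS, ⟨(hD _ _).2 ⟨_, hFg _ _ ht, e2, e1, rfl⟩,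
        (hD _ _).2 ⟨_, hFg _ _ ht, e2, e3, rfl⟩⟩, ?_⟩
      simp only [hψ _ (hFg g⁻¹ _ ht) e2, gi]
  have himg1 : ∀ g : G, (fun x => β g (ψ x) * oneS) ''
      ((fun s => s * (β g⁻¹ e * oneS)) '' SinvH β oneS H) =
      (fun s => s * (β g e * oneS)) '' SinvH β oneS H := by
    intro g
    have := himg g g⁻¹
    rw [Set.inter_self, mul_inv_cancel] at this
    rw [this, Set.inter_eq_left]
    intro x hx
    obtain ⟨t, ht, a, b, rfl⟩ := (hD _ _).1 hx
    exact (hD _ _).2 ⟨t, ht, a, by rw [b1, a], rfl⟩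
  refine ⟨fun g => ⟨?_, hC _ (hFg g e heF)⟩, fun g g' hg => by rw [hFc g g' hg e heF], fun g => ?_,
    fun g x hx y hy => ⟨?_, ?_⟩, fun g g' hg x hx => ?_, fun s hS => ?_, himg, fun g l x hx => ?_⟩
  · linear_combination (oneS * oneS) * hgee g + β g e * honeS
  · refine ⟨fun x hx => ?_, fun x hx y hy hxy => ?_, (himg1 g).ge⟩
    · rw [← himg1 g]
      exact ⟨x, hx, rfl⟩
    · obtain ⟨t, ht, a, b, rfl⟩ := (hD _ _).1 hx
      obtain ⟨t', ht', a', b', rfl⟩ := (hD _ _).1 hy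
      simp only [hψ _ ht a, hψ _ ht' a'] at hxy
      have e2 := congrArg (β g) b
      have e2' := congrArg (β g) b'
      rw [map_mul, gi] at e2 e2'
      have h9 := congrArg ψ hxy
      rw [hψ _ (hFg g t ht) e2, hψ _ (hFg g t' ht') e2'] at h9
      rw [(β g).injective h9]
  · rw [hadd, map_add, add_mul]
  · obtain ⟨t, ht, a, b, rfl⟩ := (hD _ _).1 hx
    obtain ⟨t', ht', a', b', rfl⟩ := (hD _ _).1 hy
    have : t * oneS * (t' * oneS) = t * t' * oneS := by linear_combination t * t' * honeS
    rw [this, hψ _ ht a, hψ _ ht' a', hψ _ (hFm _ ht _ ht') (by rw [mul_assoc, a']), map_mul]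
    linear_combination (-(β g t * β g t')) * honeS
  · obtain ⟨t, ht, a, b, rfl⟩ := (hD _ _).1 hx
    simp only [hψ _ ht a]
    rw [hFc g g' hg t ht]
  · rw [b1, (hB s hS).2.2]
  · obtain ⟨t, ht, a, b, rfl⟩ := (hD _ _).1 hx.1
    have e2 := congrArg (β l) b
    rw [map_mul, gi] at e2
    rw [hψ _ ht a, hψ _ (hFg l t ht) e2, bm]
end

section
/- Assume H is normal in G. Then (T^H, β_{G/H}), where β_{gH} = β_g|_{T^H}, is a globalization of (S^{α_H}, α_{G/H}) via ψ_H; explicitly: ψ_H restricted to S^{α_H} is an injective ring homomorphism into T^H whose image T^H·e_H is an ideal of T^H, and for all g ∈ G: ψ_H(D̃_{gH}) = ψ_H(S^{α_H}) ∩ β_g(ψ_H(S^{α_H})), ψ_H(α_{gH}(x)) = β_g(ψ_H(x)) for all x ∈ D̃_{g⁻¹H}, and T^H = Σ_{g∈G} β_g(ψ_H(S^{α_H})). -/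
open Finset

variable {T : Type*} [CommRing T] {G : Type*} [Group G]

section helpers

def PH (β : G →* RingAut T) (oneS : T) {m : ℕ} (h : Fin (m + 1) → G) : T :=
  ∏ i : Fin (m + 1), (1 - β (h i) oneS)

lemma mul_prod_one_sub {ι : Type*} (s : Finset ι) (f : ι → T) (y : T)
    (hy : ∀ i ∈ s, y * f i = 0) : y * ∏ i ∈ s, (1 - f i) = y := by
  classical
  induction s using Finset.induction_on with
  | empty => simp
  | insert a s ha ih =>
    rw [Finset.prod_insert ha, ← mul_assoc, mul_sub, hy a (by simp), mul_one, sub_zero]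
    exact ih (fun i hi => hy i (by simp [hi]))

lemma one_sub_prod_comb {ι : Type*} (R : Subring T) (s : Finset ι) (f : ι → T)
    (hf : ∀ i, f i ∈ R) :
    ∃ d : ι → T, (∀ i, d i ∈ R) ∧ 1 - ∏ i ∈ s, (1 - f i) = ∑ i ∈ s, d i * f i := by
  classical
  induction s using Finset.induction_on with
  | empty => exact ⟨fun _ => 0, fun _ => R.zero_mem, by simp⟩
  | insert a s ha ih =>
    obtain ⟨d, hd, hs⟩ := ih
    refine ⟨Function.update d a (∏ i ∈ s, (1 - f i)), ?_, ?_⟩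
    · intro i
      by_cases hi : i = a
      · subst hi
        simp only [Function.update_self]
        exact R.prod_mem (fun j _ => R.sub_mem R.one_mem (hf j))
      · simpa [hi] using hd i
    · rw [Finset.prod_insert ha, Finset.sum_insert ha, Function.update_self]
      have : ∑ i ∈ s, Function.update d a (∏ i ∈ s, (1 - f i)) i * f i = ∑ i ∈ s, d i * f i := by
        refine Finset.sum_congr rfl (fun i hi => ?_)
        rw [Function.update_of_ne]
        rintro rfl
        exact ha hi
      rw [this, ← hs]
      ring

def TFixR (β : G →* RingAut T) (H : Subgroup G) : Subring T where
  carrier := TFix β H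
  mul_mem' := fun ha hb g hg => by rw [map_mul, ha g hg, hb g hg]
  one_mem' := fun g hg => map_one _
  add_mem' := fun ha hb g hg => by rw [map_add, ha g hg, hb g hg]
  zero_mem' := fun g hg => map_zero _
  neg_mem' := fun ha g hg => by rw [map_neg, ha g hg]

lemma beta_mul (β : G →* RingAut T) (a b : G) (x : T) : β (a * b) x = β a (β b x) := by
  rw [map_mul]; rfl

lemma beta_one (β : G →* RingAut T) (x : T) : β 1 x = x := by
  rw [map_one]; rfl

end helpers

/-- for `H` normal in `G`, `(T^H, β_{G/H})` is a globalization of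
`(S^{α_H}, α_{G/H})` via `ψ_H`: `ψ_H` restricted to `S^{α_H}` is an injective ring
homomorphism into `T^H` whose image is an ideal of `T^H`, and the conditions (G2),
(G3), (G4) hold. -/
theorem quotient_globalization {T : Type*} [CommRing T] {G : Type*} [Group G] [Fintype G]
    (β : G →* RingAut T) (oneS : T) (honeS : oneS * oneS = oneS)
    (hglob : ∀ t : T, ∃ c : G → T, t = ∑ g : G, β g (c g * oneS))
    (H : Subgroup G) (hN : H.Normal) {m : ℕ} (h : Fin (m + 1) → G)
    (hinj : Function.Injective h) (hrange : Set.range h = (H : Set G))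
    (h1 : h 0 = 1) :
    -- ψ_H maps S^{α_H} into T^H, injectively and as a ring homomorphism
    (∀ s ∈ SinvH β oneS H, psiH β oneS h s ∈ TFix β H) ∧
    Set.InjOn (psiH β oneS h) (SinvH β oneS H) ∧
    (∀ s ∈ SinvH β oneS H, ∀ t ∈ SinvH β oneS H,
      psiH β oneS h (s + t) = psiH β oneS h s + psiH β oneS h t ∧
      psiH β oneS h (s * t) = psiH β oneS h s * psiH β oneS h t) ∧
    -- the image ψ_H(S^{α_H}) = T^H·e_H is an ideal of T^H
    (∀ t ∈ TFix β H, ∀ x ∈ psiH β oneS h '' SinvH β oneS H,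
      t * x ∈ psiH β oneS h '' SinvH β oneS H) ∧
    -- (G2)
    (∀ g : G, psiH β oneS h '' DtH β oneS H h g =
      (psiH β oneS h '' SinvH β oneS H) ∩ (β g '' (psiH β oneS h '' SinvH β oneS H))) ∧
    -- (G3)
    (∀ g : G, ∀ x ∈ DtH β oneS H h g⁻¹,
      psiH β oneS h (aMapH β oneS h g x) = β g (psiH β oneS h x)) ∧
    -- (G4)
    (∀ t ∈ TFix β H, ∃ c : G → T, (∀ g : G, c g ∈ SinvH β oneS H) ∧
      t = ∑ g : G, β g (psiH β oneS h (c g))) := by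
  have bb := beta_mul β
  have b1 := beta_one β
  have hmem : ∀ i, h i ∈ H := fun i => by
    have : h i ∈ (H : Set G) := hrange ▸ Set.mem_range_self i
    exact this
  have hex : ∀ k ∈ H, ∃ i, h i = k := fun k hk => by
    have : k ∈ Set.range h := hrange ▸ hk
    exact this
  have hid : ∀ g, β g oneS * β g oneS = β g oneS := fun g => by rw [← map_mul, honeS]
  set P := PH β oneS h with hP
  set E := psiH β oneS h oneS with hE
  have hsum : ∑ i, eIdem β oneS h i = 1 - P := by
    rw [hP, PH, Finset.prod_one_sub_ordered, sub_sub_cancel]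
    exact Finset.sum_congr rfl (fun i _ => mul_comm _ _)
  have hbe : ∀ i, β (h i) oneS * eIdem β oneS h i = eIdem β oneS h i := fun i => by
    unfold eIdem
    linear_combination (∏ j ∈ Finset.univ.filter (fun j => j < i), (1 - β (h j) oneS)) * hid (h i)
  have hEP : E = 1 - P := by
    rw [← hsum]
    exact Finset.sum_congr rfl (fun i _ => hbe i)
  have hP0 : ∀ k ∈ H, P * β k oneS = 0 := fun k hk => by
    obtain ⟨i, rfl⟩ := hex k hk
    obtain ⟨q, hq⟩ : (1 - β (h i) oneS) ∣ P := Finset.dvd_prod_of_mem _ (Finset.mem_univ i)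
    rw [hq]
    linear_combination (-q) * hid (h i)
  have hyP : ∀ y, (∀ k ∈ H, y * β k oneS = 0) → y * P = y := fun y hy =>
    mul_prod_one_sub _ _ y (fun i _ => hy _ (hmem i))
  have hPfix : ∀ k ∈ H, β k P = P := fun k hk => by
    have hQ : ∀ l ∈ H, β k P * β l oneS = 0 := fun l hl => by
      have : β l oneS = β k (β (k⁻¹ * l) oneS) := by rw [← bb, mul_inv_cancel_left]
      rw [this, ← map_mul, hP0 _ (H.mul_mem (H.inv_mem hk) hl), map_zero]
    have e1 := hyP _ hQ
    have hQ2 : ∀ l ∈ H, β k⁻¹ P * β l oneS = 0 := fun l hl => by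
      have : β l oneS = β k⁻¹ (β (k * l) oneS) := by rw [← bb, inv_mul_cancel_left]
      rw [this, ← map_mul, hP0 _ (H.mul_mem hk hl), map_zero]
    have e2 := congrArg (β k) (hyP _ hQ2)
    rw [map_mul, ← bb, mul_inv_cancel, b1] at e2
    rw [← e1, mul_comm, e2]
  have hEfix : ∀ k ∈ H, β k E = E := fun k hk => by rw [hEP, map_sub, map_one, hPfix k hk]
  have hEk : ∀ k ∈ H, β k oneS * E = β k oneS := fun k hk => by
    rw [hEP]; linear_combination - hP0 k hk
  have hPP : P * P = P := hyP P hP0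
  have hEE : E * E = E := by rw [hEP]; linear_combination hPP
  -- symmetric form of invariance
  have hsym : ∀ s ∈ SinvH β oneS H, ∀ k ∈ H, ∀ l ∈ H,
      β k s * β l oneS = β l s * β k oneS := fun s hs k hk l hl => by
    have := congrArg (β l) (hs.2 (l⁻¹ * k) (H.mul_mem (H.inv_mem hl) hk))
    rw [bb, bb, map_mul (β l), map_mul (β l), map_mul (β l), ← bb l⁻¹, ← bb l⁻¹, ← bb l, ← bb l,
      mul_inv_cancel_left] at this
    have h2 := congrArg (β l) hs.1
    rw [map_mul] at h2
    linear_combination this + β k oneS * h2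
  have hkey : ∀ s ∈ SinvH β oneS H, ∀ k ∈ H, β k oneS * psiH β oneS h s = β k s :=
      fun s hs k hk => by
    have h2 := congrArg (β k) hs.1
    rw [map_mul] at h2
    have : β k oneS * psiH β oneS h s = β k s * E := by
      rw [hEP, ← hsum, psiH, Finset.mul_sum, Finset.mul_sum]
      refine Finset.sum_congr rfl (fun i _ => ?_)
      linear_combination eIdem β oneS h i * hsym s hs _ (hmem i) k hk + β k s * hbe i
    rw [this]
    linear_combination (E - 1) * (-h2) + β k s * hEk k hk
  have hpE : ∀ s, psiH β oneS h s * E = psiH β oneS h s := fun s => by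
    rw [psiH, Finset.sum_mul]
    refine Finset.sum_congr rfl (fun i _ => ?_)
    linear_combination (E - 1) * (-(β (h i) s * hbe i)) + β (h i) s * eIdem β oneS h i * hEk _ (hmem i)
  have hret : ∀ s ∈ SinvH β oneS H, psiH β oneS h s * oneS = s := fun s hs => by
    have := hkey s hs 1 H.one_mem
    rw [b1, b1] at this
    rw [mul_comm, this]
  have hfix : ∀ s ∈ SinvH β oneS H, psiH β oneS h s ∈ TFixR β H := fun s hs k hk => by
    set x := psiH β oneS h s with hx
    have hz : ∀ l ∈ H, (β k x - x) * β l oneS = 0 := fun l hl => by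
      have e : β l oneS = β k (β (k⁻¹ * l) oneS) := by rw [← bb, mul_inv_cancel_left]
      have e1 : β k x * β l oneS = β l s := by
        rw [e, ← map_mul, mul_comm, hkey s hs _ (H.mul_mem (H.inv_mem hk) hl), ← bb,
          mul_inv_cancel_left]
      linear_combination e1 - hkey s hs l hl
    have e1 := hyP _ hz
    have e2 := hpE s
    rw [← hx] at e2
    have e3 := congrArg (β k) e2
    rw [map_mul, hEfix k hk] at e3
    rw [hEP] at e2 e3
    linear_combination - e1 + e2 - e3
  have hin : ∀ t ∈ TFixR β H, t * oneS ∈ SinvH β oneS H := fun t ht =>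
    ⟨by rw [mul_assoc, honeS], fun g hg => by
      rw [map_mul, ht g hg]; linear_combination - t * β g oneS * honeS⟩
  have hpt : ∀ t ∈ TFixR β H, psiH β oneS h (t * oneS) = t * E := fun t ht => by
    rw [hE, psiH, psiH, Finset.mul_sum]
    refine Finset.sum_congr rfl (fun i _ => ?_)
    rw [map_mul, ht _ (hmem i), mul_assoc]
  have hER : E ∈ TFixR β H := hEfix
  have hgR : ∀ g, ∀ t ∈ TFixR β H, β g t ∈ TFixR β H := fun g t ht k hk => by
    have e : k * g = g * (g⁻¹ * k * g) := by group
    have hm : g⁻¹ * k * g ∈ H := by simpa using hN.conj_mem k hk g⁻¹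
    rw [← bb, e, bb, ht _ hm]
  have himg : ∀ x, x ∈ psiH β oneS h '' SinvH β oneS H ↔ x ∈ TFixR β H ∧ x * E = x := fun x => by
    constructor
    · rintro ⟨s, hs, rfl⟩
      exact ⟨hfix s hs, hpE s⟩
    · rintro ⟨hx, hxE⟩
      exact ⟨x * oneS, hin x hx, by rw [hpt x hx, hxE]⟩
  -- elements of D̃
  have hD : ∀ g, ∀ x, x ∈ DtH β oneS H h g ↔
      ∃ y ∈ TFixR β H, y * E = y ∧ x = y * β g E * oneS := fun g x => by
    constructor
    · rintro ⟨s, hs, rfl⟩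
      refine ⟨psiH β oneS h s, hfix s hs, hpE s, ?_⟩
      simp only [tilde1, ← hE]
      linear_combination (- (β g E * oneS)) * hret s hs + psiH β oneS h s * β g E * honeS
    · rintro ⟨y, hy, hyE, rfl⟩
      refine ⟨y * oneS, hin y hy, ?_⟩
      simp only [tilde1, ← hE]
      linear_combination y * β g E * honeS
  refine ⟨hfix, ?_, ?_, ?_, ?_, ?_, ?_⟩
  · intro s hs t ht hst
    rw [← hret s hs, ← hret t ht, hst]
  · intro s hs t ht
    refine ⟨?_, ?_⟩
    · simp only [psiH, map_add, add_mul, Finset.sum_add_distrib]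
    · have e : s * t = (psiH β oneS h s * psiH β oneS h t) * oneS := by
        conv_lhs => rw [← hret s hs, ← hret t ht]
        linear_combination psiH β oneS h s * psiH β oneS h t * honeS
      rw [e, hpt _ ((TFixR β H).mul_mem (hfix s hs) (hfix t ht)), mul_assoc, hpE]
  · intro t ht x hx
    rw [himg] at hx ⊢
    exact ⟨(TFixR β H).mul_mem ht hx.1, by rw [mul_assoc, hx.2]⟩
  · intro g
    ext x
    constructor
    · rintro ⟨z, hz, rfl⟩
      obtain ⟨y, hy, hyE, rfl⟩ := (hD g z).1 hz
      have hyR := (TFixR β H).mul_mem hy (hgR g E hER)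
      rw [hpt _ hyR]
      refine ⟨(himg _).2 ⟨(TFixR β H).mul_mem hyR hER, by rw [mul_assoc, hEE]⟩, ?_⟩
      refine ⟨β g⁻¹ y * E, (himg _).2 ⟨(TFixR β H).mul_mem (hgR _ _ hy) hER,
        by rw [mul_assoc, hEE]⟩, ?_⟩
      rw [map_mul, ← bb, mul_inv_cancel, b1]
      linear_combination - β g E * hyE
    · rintro ⟨hx1, w, hw, rfl⟩
      obtain ⟨hx, hxE⟩ := (himg _).1 hx1
      obtain ⟨hw1, hw2⟩ := (himg _).1 hw
      refine ⟨β g w * β g E * oneS, (hD g _).2 ⟨β g w, hx, hxE, rfl⟩, ?_⟩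
      rw [← map_mul, hw2, hpt _ hx, hxE]
  · intro g x hx
    obtain ⟨y, hy, hyE, rfl⟩ := (hD g⁻¹ x).1 hx
    have hyR := (TFixR β H).mul_mem hy (hgR g⁻¹ E hER)
    have e : y * β g⁻¹ E * E = y * β g⁻¹ E := by linear_combination β g⁻¹ E * hyE
    unfold aMapH
    rw [hpt _ hyR, e, hpt _ (hgR g _ hyR), map_mul, ← bb, mul_inv_cancel, b1, mul_assoc, hEE]
  · intro t ht
    obtain ⟨d, hd, hds⟩ := one_sub_prod_comb (TFixR β H) Finset.univ (fun g => β g E)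
      (fun g => hgR g E hER)
    have h0 : ∏ g : G, (1 - β g E) = 0 := by
      have hz : ∀ g, (∏ g : G, (1 - β g E)) * β g oneS = 0 := fun g => by
        obtain ⟨q, hq⟩ : (1 - β g E) ∣ ∏ g : G, (1 - β g E) :=
          Finset.dvd_prod_of_mem (fun g => 1 - β g E) (Finset.mem_univ g)
        have e := congrArg (β g) (hEk 1 H.one_mem)
        rw [b1, map_mul] at e
        rw [hq]
        linear_combination (-q) * e
      obtain ⟨c, hc⟩ := hglob 1
      generalize (∏ g : G, (1 - β g E)) = X at hz ⊢
      rw [← mul_one X, hc, Finset.mul_sum]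
      refine Finset.sum_eq_zero (fun g _ => ?_)
      rw [map_mul]
      linear_combination β g (c g) * hz g
    rw [h0, sub_zero] at hds
    have hR : ∀ g, β g⁻¹ (t * d g) ∈ TFixR β H := fun g =>
      hgR _ _ ((TFixR β H).mul_mem ht (hd g))
    refine ⟨fun g => β g⁻¹ (t * d g) * oneS, fun g => hin _ (hR g), ?_⟩
    conv_lhs => rw [← mul_one t, hds, Finset.mul_sum]
    refine Finset.sum_congr rfl (fun g _ => ?_)
    rw [hpt _ (hR g), map_mul, ← bb, mul_inv_cancel, b1, mul_assoc]
end

section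
/- Assume H is normal in G. Then there exist elements x_1, …, x_n, y_1, …, y_n ∈ S^{α_H} such that for every g ∈ G, Σ_{i=1}^{n} x_i·α_{gH}(y_i·1̃_{g⁻¹H}) equals 1_S if g ∈ H and 0 otherwise (i.e. S^{α_H} is an α_{G/H}-partial Galois extension of S^α), if and only if there exist u_1, …, u_r, v_1, …, v_r ∈ T^H such that for every g ∈ G, Σ_{j=1}^{r} u_j·β_g(v_j) equals 1_T if g ∈ H and 0 otherwise (i.e. T^H is a G/H-Galois extension of T^G). -/
open Finset

variable {T : Type*} [CommRing T] {G : Type*} [Group G]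

theorem aux_idem (β : G →* RingAut T) (oneS : T) (honeS : oneS * oneS = oneS) (g : G) :
    β g oneS * β g oneS = β g oneS := by
  rw [← map_mul, honeS]

theorem aux_bb (β : G →* RingAut T) (a b : G) (t : T) : β a (β b t) = β (a * b) t := by
  rw [map_mul]; rfl

theorem aux_b1 (β : G →* RingAut T) (t : T) : β 1 t = t := by
  rw [map_one]; rfl

theorem aux_E_sum (β : G →* RingAut T) (oneS : T) (honeS : oneS * oneS = oneS)
    {m : ℕ} (h : Fin (m + 1) → G) :
    psiH β oneS h oneS = ∑ i, eIdem β oneS h i := by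
  unfold psiH
  refine Finset.sum_congr rfl fun i _ => ?_
  unfold eIdem
  linear_combination (∏ j ∈ Finset.univ.filter (fun j => j < i), (1 - β (h j) oneS)) *
    aux_idem β oneS honeS (h i)

theorem aux_E_prod (β : G →* RingAut T) (oneS : T) (honeS : oneS * oneS = oneS)
    {m : ℕ} (h : Fin (m + 1) → G) :
    psiH β oneS h oneS = 1 - ∏ i, (1 - β (h i) oneS) := by
  rw [aux_E_sum β oneS honeS, Finset.prod_one_sub_ordered]
  rw [sub_sub_cancel]
  refine Finset.sum_congr rfl fun i _ => ?_
  unfold eIdem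
  ring

theorem aux_E_mul (β : G →* RingAut T) (oneS : T) (honeS : oneS * oneS = oneS)
    {m : ℕ} (h : Fin (m + 1) → G) (j : Fin (m + 1)) :
    psiH β oneS h oneS * β (h j) oneS = β (h j) oneS := by
  rw [aux_E_prod β oneS honeS]
  have : (∏ i, (1 - β (h i) oneS)) * β (h j) oneS = 0 := by
    rw [← Finset.mul_prod_erase _ _ (Finset.mem_univ j)]
    linear_combination (-(∏ i ∈ Finset.univ.erase j, (1 - β (h i) oneS))) *
      aux_idem β oneS honeS (h j)
  linear_combination -this

/-- separation: an element of `T e_H` killed by all `β_h(1_S)` vanishes -/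
theorem aux_sep (β : G →* RingAut T) (oneS : T) (honeS : oneS * oneS = oneS)
    {m : ℕ} (h : Fin (m + 1) → G) (a b : T) (ha : a * psiH β oneS h oneS = a)
    (hb : b * psiH β oneS h oneS = b)
    (hab : ∀ j, a * β (h j) oneS = b * β (h j) oneS) : a = b := by
  rw [← ha, ← hb, aux_E_sum β oneS honeS, Finset.mul_sum, Finset.mul_sum]
  refine Finset.sum_congr rfl fun i _ => ?_
  unfold eIdem
  linear_combination (∏ j ∈ Finset.univ.filter (fun j => j < i), (1 - β (h j) oneS)) * hab i

theorem aux_psi_res (β : G →* RingAut T) (oneS : T) (honeS : oneS * oneS = oneS)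
    (H : Subgroup G) {m : ℕ} (h : Fin (m + 1) → G) (hrange : Set.range h = (H : Set G))
    (s : T) (hs : s ∈ SinvH β oneS H) (j : Fin (m + 1)) :
    psiH β oneS h s * β (h j) oneS = β (h j) s := by
  have hm : ∀ i, h i ∈ H := fun i => by
    have : h i ∈ Set.range h := ⟨i, rfl⟩
    rwa [hrange] at this
  obtain ⟨hs1, hs2⟩ := hs
  have key : ∀ i, β (h i) s * β (h j) oneS = β (h j) s * β (h i) oneS := by
    intro i
    have h3 := hs2 ((h j)⁻¹ * h i) (H.mul_mem (H.inv_mem (hm j)) (hm i))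
    have h4 := congrArg (β (h j)) h3
    simp only [map_mul (β (h j)), aux_bb, mul_inv_cancel_left] at h4
    have h5 : β (h j) s * β (h j) oneS = β (h j) s := by rw [← map_mul, hs1]
    linear_combination h4 + β (h i) oneS * h5
  have h5 : β (h j) s * β (h j) oneS = β (h j) s := by rw [← map_mul, hs1]
  have h6 : psiH β oneS h s * β (h j) oneS = β (h j) s * psiH β oneS h oneS := by
    unfold psiH
    rw [Finset.sum_mul, Finset.mul_sum]
    refine Finset.sum_congr rfl fun i _ => ?_
    linear_combination eIdem β oneS h i * key i
  rw [h6]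
  linear_combination β (h j) s * aux_E_mul β oneS honeS h j +
    (1 - psiH β oneS h oneS) * h5

theorem aux_E_idem (β : G →* RingAut T) (oneS : T) (honeS : oneS * oneS = oneS)
    {m : ℕ} (h : Fin (m + 1) → G) (i : Fin (m + 1)) :
    eIdem β oneS h i * psiH β oneS h oneS = eIdem β oneS h i := by
  have := aux_E_mul β oneS honeS h i
  unfold eIdem
  linear_combination (∏ j ∈ Finset.univ.filter (fun j => j < i), (1 - β (h j) oneS)) * this

theorem aux_psi_E (β : G →* RingAut T) (oneS : T) (honeS : oneS * oneS = oneS)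
    {m : ℕ} (h : Fin (m + 1) → G) (s : T) :
    psiH β oneS h s * psiH β oneS h oneS = psiH β oneS h s := by
  conv_lhs => rw [psiH]
  rw [Finset.sum_mul]
  conv_rhs => rw [psiH]
  refine Finset.sum_congr rfl fun i _ => ?_
  rw [mul_assoc, aux_E_idem β oneS honeS]

theorem aux_oneS_mem (β : G →* RingAut T) (oneS : T) (honeS : oneS * oneS = oneS)
    (H : Subgroup G) : oneS ∈ SinvH β oneS H :=
  ⟨honeS, fun g _ => by linear_combination (-β g oneS) * honeS⟩

theorem aux_E_fix (β : G →* RingAut T) (oneS : T) (honeS : oneS * oneS = oneS)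
    (H : Subgroup G) {m : ℕ} (h : Fin (m + 1) → G) (hinj : Function.Injective h)
    (hrange : Set.range h = (H : Set G)) :
    psiH β oneS h oneS ∈ TFix β H := by
  intro g hg
  have hm : ∀ i, h i ∈ H := fun i => by
    have : h i ∈ Set.range h := ⟨i, rfl⟩
    rwa [hrange] at this
  have hex : ∀ i, ∃ k, h k = g * h i := fun i => by
    have : g * h i ∈ Set.range h := by rw [hrange]; exact H.mul_mem hg (hm i)
    exact this
  choose σ hσ using hex
  have hσi : Function.Injective σ := fun a b hab => by
    have := hσ a
    rw [hab, hσ b] at this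
    exact (hinj (mul_left_cancel this)).symm
  have hσb : Function.Bijective σ := Finite.injective_iff_bijective.mp hσi
  rw [aux_E_prod β oneS honeS, map_sub, map_one, map_prod]
  congr 1
  refine Fintype.prod_bijective σ hσb _ _ fun i => ?_
  rw [map_sub, map_one, aux_bb, hσ]

theorem aux_psi_fix (β : G →* RingAut T) (oneS : T) (honeS : oneS * oneS = oneS)
    (H : Subgroup G) {m : ℕ} (h : Fin (m + 1) → G) (hinj : Function.Injective h)
    (hrange : Set.range h = (H : Set G)) (s : T) (hs : s ∈ SinvH β oneS H) :
    psiH β oneS h s ∈ TFix β H := by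
  intro g hg
  have hm : ∀ i, h i ∈ H := fun i => by
    have : h i ∈ Set.range h := ⟨i, rfl⟩
    rwa [hrange] at this
  refine aux_sep β oneS honeS h _ _ ?_ (aux_psi_E β oneS honeS h s) ?_
  · have := aux_E_fix β oneS honeS H h hinj hrange g hg
    conv_lhs => rw [← this]
    rw [← map_mul, aux_psi_E β oneS honeS]
  · intro j
    have : g⁻¹ * h j ∈ Set.range h := by
      rw [hrange]; exact H.mul_mem (H.inv_mem hg) (hm j)
    obtain ⟨k, hk⟩ := this
    have h2 := congrArg (β g) (aux_psi_res β oneS honeS H h hrange s hs k)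
    rw [map_mul, aux_bb, aux_bb, hk, mul_inv_cancel_left] at h2
    rw [h2, aux_psi_res β oneS honeS H h hrange s hs j]

theorem aux_psi_mul (β : G →* RingAut T) (oneS : T)
    (H : Subgroup G) {m : ℕ} (h : Fin (m + 1) → G)
    (hrange : Set.range h = (H : Set G)) (s w : T) (hw : w ∈ TFix β H) :
    psiH β oneS h (s * w) = psiH β oneS h s * w := by
  unfold psiH
  rw [Finset.sum_mul]
  refine Finset.sum_congr rfl fun i _ => ?_
  have : h i ∈ Set.range h := ⟨i, rfl⟩
  rw [hrange] at this
  rw [map_mul, hw _ this]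
  ring

theorem aux_conj_fix (β : G →* RingAut T) (H : Subgroup G) (hN : H.Normal) (g : G) (w : T)
    (hw : w ∈ TFix β H) : β g w ∈ TFix β H := by
  intro k hk
  have h1 : g⁻¹ * k * g ∈ H := by
    have := hN.conj_mem k hk g⁻¹
    rwa [inv_inv] at this
  have h2 := congrArg (β g) (hw _ h1)
  rw [aux_bb] at h2
  rw [aux_bb, ← h2]
  congr 2
  group

theorem aux_alpha (β : G →* RingAut T) (oneS : T) (honeS : oneS * oneS = oneS)
    (H : Subgroup G) (hN : H.Normal) {m : ℕ} (h : Fin (m + 1) → G)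
    (hinj : Function.Injective h)
    (hrange : Set.range h = (H : Set G)) (h1 : h 0 = 1) (g : G) (y : T)
    (hy : y ∈ SinvH β oneS H) :
    aMapH β oneS h g (y * tilde1 β oneS h g⁻¹) = β g (psiH β oneS h y) * oneS := by
  have hE := aux_conj_fix β H hN g⁻¹ _ (aux_E_fix β oneS honeS H h hinj hrange)
  have e1 : y * tilde1 β oneS h g⁻¹ = y * β g⁻¹ (psiH β oneS h oneS) := by
    unfold tilde1
    linear_combination β g⁻¹ (psiH β oneS h oneS) * hy.1
  have e2 := aux_E_mul β oneS honeS h 0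
  rw [h1, aux_b1] at e2
  rw [e1, aMapH, aux_psi_mul β oneS H h hrange _ _ hE, map_mul, aux_bb, mul_inv_cancel, aux_b1,
    mul_assoc, e2]

theorem aux_cover (β : G →* RingAut T) (H : Subgroup G) (hN : H.Normal) (E : T)
    (hE : E ∈ TFix β H) (s : Finset G) :
    ∃ f : G → T, (∀ g, f g ∈ TFix β H) ∧
      ∑ g ∈ s, f g * β g E = 1 - ∏ g ∈ s, (1 - β g E) := by
  classical
  induction s using Finset.induction_on with
  | empty => exact ⟨fun _ => 0, fun g k _ => map_zero _, by simp⟩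
  | insert a s ha ih =>
    obtain ⟨f, hf, hsum⟩ := ih
    refine ⟨Function.update f a (∏ g ∈ s, (1 - β g E)), ?_, ?_⟩
    · intro g
      by_cases hg : g = a
      · subst hg
        rw [Function.update_self]
        intro k hk
        rw [map_prod]
        refine Finset.prod_congr rfl fun i _ => ?_
        rw [map_sub, map_one, aux_conj_fix β H hN i E hE k hk]
      · rw [Function.update_of_ne hg]; exact hf g
    · rw [Finset.sum_insert ha, Finset.prod_insert ha, Function.update_self]
      have : ∑ g ∈ s, Function.update f a (∏ g ∈ s, (1 - β g E)) g * β g E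
          = ∑ g ∈ s, f g * β g E := by
        refine Finset.sum_congr rfl fun i hi => ?_
        have hne : i ≠ a := fun hh => ha (hh ▸ hi)
        rw [Function.update_of_ne hne]
      rw [this, hsum]
      ring

/-- for `H` normal in `G`, `S^{α_H}` is an `α_{G/H}`-partial Galois
extension of `S^α` if and only if `T^H` is a `G/H`-Galois extension of `T^G`. -/
theorem partialGalois_quotient_iff_global {T : Type*} [CommRing T] {G : Type*} [Group G]
    [Fintype G]
    (β : G →* RingAut T) (oneS : T) (honeS : oneS * oneS = oneS)
    (hglob : ∀ t : T, ∃ c : G → T, t = ∑ g : G, β g (c g * oneS))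
    (H : Subgroup G) (hN : H.Normal) {m : ℕ} (h : Fin (m + 1) → G)
    (hinj : Function.Injective h) (hrange : Set.range h = (H : Set G))
    (h1 : h 0 = 1) :
    (∃ (n : ℕ) (x y : Fin n → T),
      (∀ i, x i ∈ SinvH β oneS H ∧ y i ∈ SinvH β oneS H) ∧
      (∀ g ∈ H, ∑ i, x i * aMapH β oneS h g (y i * tilde1 β oneS h g⁻¹) = oneS) ∧
      (∀ g ∉ H, ∑ i, x i * aMapH β oneS h g (y i * tilde1 β oneS h g⁻¹) = 0)) ↔
    (∃ (r : ℕ) (u v : Fin r → T),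
      (∀ j, u j ∈ TFix β H ∧ v j ∈ TFix β H) ∧
      (∀ g ∈ H, ∑ j, u j * β g (v j) = 1) ∧
      (∀ g ∉ H, ∑ j, u j * β g (v j) = 0)) := by
  have hE := aux_E_fix β oneS honeS H h hinj hrange
  have hE1 : psiH β oneS h oneS * oneS = oneS := by
    have e2 := aux_E_mul β oneS honeS h 0
    rwa [h1, aux_b1] at e2
  constructor
  · rintro ⟨n, x, y, hxy, hin, hout⟩
    have hal : ∀ g, ∑ i, x i * aMapH β oneS h g (y i * tilde1 β oneS h g⁻¹)
        = ∑ i, x i * β g (psiH β oneS h (y i)) := by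
      intro g
      refine Finset.sum_congr rfl fun i _ => ?_
      rw [aux_alpha β oneS honeS H hN h hinj hrange h1 g _ (hxy i).2]
      linear_combination β g (psiH β oneS h (y i)) * (hxy i).1.1
    have hpsi : ∀ g, ∑ i, psiH β oneS h (x i) * β g (psiH β oneS h (y i))
        = psiH β oneS h (∑ i, x i * β g (psiH β oneS h (y i))) := by
      intro g
      have hadd : psiH β oneS h (∑ i, x i * β g (psiH β oneS h (y i)))
          = ∑ i, psiH β oneS h (x i * β g (psiH β oneS h (y i))) := by
        unfold psiH
        simp only [map_sum, Finset.sum_mul]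
        rw [Finset.sum_comm]
      rw [hadd]
      refine Finset.sum_congr rfl fun i _ => ?_
      rw [aux_psi_mul β oneS H h hrange]
      exact aux_conj_fix β H hN g _ (aux_psi_fix β oneS honeS H h hinj hrange _ (hxy i).2)
    have hin2 : ∀ g ∈ H, ∑ i, psiH β oneS h (x i) * β g (psiH β oneS h (y i))
        = psiH β oneS h oneS := fun g hg => by
      rw [hpsi, ← hal, hin g hg]
    have hout2 : ∀ g ∉ H, ∑ i, psiH β oneS h (x i) * β g (psiH β oneS h (y i)) = 0 :=
      fun g hg => by
        rw [hpsi, ← hal, hout g hg]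
        simp [psiH]
    obtain ⟨f, hf, hsum⟩ := aux_cover β H hN _ hE Finset.univ
    have hP : ∏ g : G, (1 - β g (psiH β oneS h oneS)) = 0 := by
      obtain ⟨c, hc⟩ := hglob 1
      classical
      refine (mul_one _).symm.trans ((congrArg (_ * ·) hc).trans ?_)
      beta_reduce
      rw [Finset.mul_sum]
      refine Finset.sum_eq_zero fun k _ => ?_
      rw [← Finset.mul_prod_erase _ _ (Finset.mem_univ k)]
      have h3 : (1 - β k (psiH β oneS h oneS)) * β k (c k * oneS) = 0 := by
        rw [← map_one (β k), ← map_sub, ← map_mul]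
        have : (1 - psiH β oneS h oneS) * (c k * oneS) = 0 := by
          linear_combination (-c k) * hE1
        rw [this, map_zero]
      linear_combination (∏ g ∈ Finset.univ.erase k, (1 - β g (psiH β oneS h oneS))) * h3
    rw [hP, sub_zero] at hsum
    have hbig : ∀ g : G, ∑ p : G × Fin n, (f p.1 * β p.1 (psiH β oneS h (x p.2))) *
        β g (β p.1 (psiH β oneS h (y p.2)))
        = ∑ k : G, f k * β k (∑ i, psiH β oneS h (x i) *
            β (k⁻¹ * g * k) (psiH β oneS h (y i))) := by
      intro g
      rw [Fintype.sum_prod_type]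
      refine Finset.sum_congr rfl fun k _ => ?_
      rw [map_sum, Finset.mul_sum]
      refine Finset.sum_congr rfl fun i _ => ?_
      rw [map_mul, aux_bb, aux_bb, mul_assoc]
      congr 4
      group
    let ε := Fintype.equivFin (G × Fin n)
    refine ⟨Fintype.card (G × Fin n),
      fun j => f (ε.symm j).1 * β (ε.symm j).1 (psiH β oneS h (x (ε.symm j).2)),
      fun j => β (ε.symm j).1 (psiH β oneS h (y (ε.symm j).2)), ?_, ?_, ?_⟩
    · intro j
      refine ⟨?_, ?_⟩
      · intro k hk
        rw [map_mul, hf _ k hk, aux_conj_fix β H hN _ _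
          (aux_psi_fix β oneS honeS H h hinj hrange _ (hxy _).1) k hk]
      · exact aux_conj_fix β H hN _ _ (aux_psi_fix β oneS honeS H h hinj hrange _ (hxy _).2)
    · intro g hg
      rw [Equiv.sum_comp ε.symm (fun p : G × Fin n =>
        (f p.1 * β p.1 (psiH β oneS h (x p.2))) * β g (β p.1 (psiH β oneS h (y p.2)))), hbig,
        ← hsum]
      refine Finset.sum_congr rfl fun k _ => ?_
      rw [hin2]
      have := hN.conj_mem g hg k⁻¹
      rwa [inv_inv] at this
    · intro g hg
      rw [Equiv.sum_comp ε.symm (fun p : G × Fin n =>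
        (f p.1 * β p.1 (psiH β oneS h (x p.2))) * β g (β p.1 (psiH β oneS h (y p.2)))), hbig]
      refine Finset.sum_eq_zero fun k _ => ?_
      rw [hout2, map_zero, mul_zero]
      intro hk
      apply hg
      have := hN.conj_mem _ hk k
      have e : k * (k⁻¹ * g * k) * k⁻¹ = g := by group
      rwa [e] at this
  · rintro ⟨r, u, v, huv, hin, hout⟩
    have hmem : ∀ w ∈ TFix β H, w * oneS ∈ SinvH β oneS H := fun w hw =>
      ⟨by linear_combination w * honeS, fun g hg => by
        rw [map_mul, hw g hg]
        linear_combination (-w * β g oneS) * honeS⟩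
    have hal : ∀ g, ∑ i, (u i * oneS) * aMapH β oneS h g (v i * oneS * tilde1 β oneS h g⁻¹)
        = (∑ i, u i * β g (v i)) * (β g (psiH β oneS h oneS) * oneS) := by
      intro g
      rw [Finset.sum_mul]
      refine Finset.sum_congr rfl fun i _ => ?_
      rw [aux_alpha β oneS honeS H hN h hinj hrange h1 g _ (hmem _ (huv i).2),
        mul_comm (v i) oneS, aux_psi_mul β oneS H h hrange _ _ (huv i).2, map_mul]
      linear_combination (u i * β g (v i) * β g (psiH β oneS h oneS)) * honeS
    refine ⟨r, fun i => u i * oneS, fun i => v i * oneS,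
      fun i => ⟨hmem _ (huv i).1, hmem _ (huv i).2⟩, ?_, ?_⟩
    · intro g hg
      rw [hal, hin g hg, hE g hg, hE1, one_mul]
    · intro g hg
      rw [hal, hout g hg, zero_mul]
end

section
/- Assume H is normal in G and that S is an α-partial Galois extension of S^α, i.e. there exist x_1, …, x_n, y_1, …, y_n ∈ S with Σ_{i=1}^{n} x_i·α_g(y_i·1_{g⁻¹}) = δ_{1,g}·1_S for every g ∈ G. Then S^{α_H} is an α_{G/H}-partial Galois extension of S^α: there exist u_1, …, u_r, v_1, …, v_r ∈ S^{α_H} such that for every g ∈ G, Σ_{j=1}^{r} u_j·α_{gH}(v_j·1̃_{g⁻¹H}) equals 1_S if g ∈ H and 0 otherwise. -/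
open Finset

variable {T : Type*} [CommRing T] {G : Type*} [Group G]

/-- Trace of `T` over the `H`-invariants hits `1` when Galois coordinates exist. -/
theorem exists_trace_one {T : Type*} [CommRing T] {G : Type*} [Group G] [Fintype G]
    (β : G →* RingAut T) (H : Subgroup G) [Fintype H] {ι : Type*} [Fintype ι] (X Y : ι → T)
    (hXY1 : ∑ i, X i * Y i = 1)
    (hXY : ∀ g : G, g ≠ 1 → ∑ i, X i * β g (Y i) = 0) :
    ∃ c : T, ∑ k : H, β k c = 1 := by
  classical
  have hinv : ∀ (t : T) (g : G), g ∈ H → β g (∑ k : H, β k t) = ∑ k : H, β k t := by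
    intro t g hg
    rw [map_sum]
    refine Fintype.sum_equiv (Equiv.mulLeft (⟨g, hg⟩ : H)) _ _ ?_
    intro k
    simp [map_mul]
  let R : Subring T :=
    { carrier := {t | ∀ g ∈ H, β g t = t}
      mul_mem' := fun {a b} ha hb g hg => by rw [map_mul, ha g hg, hb g hg]
      one_mem' := fun g _ => map_one _
      add_mem' := fun {a b} ha hb g hg => by rw [map_add, ha g hg, hb g hg]
      zero_mem' := fun g _ => map_zero _
      neg_mem' := fun {a} ha g hg => by rw [map_neg, ha g hg] }
  let tr : T → R := fun t => ⟨∑ k : H, β k t, fun g hg => hinv t g hg⟩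
  let I : Ideal R :=
    { carrier := {r | ∃ t : T, tr t = r}
      add_mem' := by
        rintro _ _ ⟨a, rfl⟩ ⟨b, rfl⟩
        refine ⟨a + b, Subtype.ext ?_⟩
        simp [tr, Finset.sum_add_distrib]
      zero_mem' := ⟨0, Subtype.ext (by simp [tr])⟩
      smul_mem' := by
        rintro r _ ⟨a, rfl⟩
        refine ⟨r * a, Subtype.ext ?_⟩
        simp only [tr, smul_eq_mul, Subring.coe_mul, map_mul, Finset.mul_sum]
        exact Finset.sum_congr rfl fun k _ => by rw [r.2 k k.2] }
  have hexp : ∀ t : T, ∑ i, (tr (Y i * t)) • X i = t := by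
    intro t
    have : ∀ i, (tr (Y i * t)) • X i = ∑ k : H, β k t * (X i * β k (Y i)) := by
      intro i
      rw [Subring.smul_def, smul_eq_mul, Finset.sum_mul]
      exact Finset.sum_congr rfl fun k _ => by rw [map_mul]; ring
    simp_rw [this]
    rw [Finset.sum_comm]
    simp_rw [← Finset.mul_sum]
    rw [Finset.sum_eq_single (1 : H)]
    · simp [hXY1]
    · intro k _ hk
      rw [hXY k (by simpa using hk), mul_zero]
    · simp
  have hfg : (⊤ : Submodule R T).FG := by
    refine ⟨Finset.univ.image X, ?_⟩
    rw [eq_top_iff]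
    intro t _
    rw [← hexp t]
    exact Submodule.sum_mem _ fun i _ => Submodule.smul_mem _ _ (Submodule.subset_span (by simp))
  have hle : (⊤ : Submodule R T) ≤ I • (⊤ : Submodule R T) := by
    intro t _
    rw [← hexp t]
    exact Submodule.sum_mem _ fun i _ => Submodule.smul_mem_smul ⟨_, rfl⟩ trivial
  obtain ⟨r, hr, hr0⟩ :=
    Submodule.exists_sub_one_mem_and_smul_eq_zero_of_fg_of_le_smul I ⊤ hfg hle
  have hr1 : r = 0 := by
    have := hr0 1 trivial
    rw [Subring.smul_def, smul_eq_mul, mul_one] at this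
    exact Subtype.ext this
  rw [hr1, zero_sub] at hr
  have h1I : (1 : R) ∈ I := by simpa using I.neg_mem hr
  obtain ⟨c, hc⟩ := h1I
  exact ⟨c, congrArg Subtype.val hc⟩

/-- for `H` normal in `G`, if `S` is an `α`-partial Galois extension of
`S^α` (there exist partial Galois coordinates `x_i, y_i ∈ S`), then `S^{α_H}` is an
`α_{G/H}`-partial Galois extension of `S^α`. -/
theorem partialGalois_quotient {T : Type*} [CommRing T] {G : Type*} [Group G] [Fintype G]
    (β : G →* RingAut T) (oneS : T) (honeS : oneS * oneS = oneS)
    (hglob : ∀ t : T, ∃ c : G → T, t = ∑ g : G, β g (c g * oneS))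
    (H : Subgroup G) (hN : H.Normal) {m : ℕ} (h : Fin (m + 1) → G)
    (hinj : Function.Injective h) (hrange : Set.range h = (H : Set G))
    (h1 : h 0 = 1)
    (hGal : ∃ (n : ℕ) (x y : Fin n → T),
      (∀ i, x i * oneS = x i ∧ y i * oneS = y i) ∧
      (∀ g : G, g = 1 →
        ∑ i, x i * (β g (y i * (β g⁻¹ oneS * oneS)) * oneS) = oneS) ∧
      (∀ g : G, g ≠ 1 →
        ∑ i, x i * (β g (y i * (β g⁻¹ oneS * oneS)) * oneS) = 0)) :
    ∃ (r : ℕ) (u v : Fin r → T),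
      (∀ j, u j ∈ SinvH β oneS H ∧ v j ∈ SinvH β oneS H) ∧
      (∀ g ∈ H, ∑ j, u j * aMapH β oneS h g (v j * tilde1 β oneS h g⁻¹) = oneS) ∧
      (∀ g ∉ H, ∑ j, u j * aMapH β oneS h g (v j * tilde1 β oneS h g⁻¹) = 0) := by
  classical
  obtain ⟨n, x, y, hxy, hg1, hgne⟩ := hGal
  -- simplified partial coordinates
  have key : ∀ g : G, ∑ i, x i * (β g (y i * (β g⁻¹ oneS * oneS)) * oneS)
      = ∑ i, x i * β g (y i) := by
    intro g
    refine Finset.sum_congr rfl fun i _ => ?_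
    have e1 : β g (β g⁻¹ oneS) = oneS := by
      rw [← RingAut.mul_apply, ← map_mul, mul_inv_cancel, map_one, RingAut.one_apply]
    have e2 : β g (y i) * β g oneS = β g (y i) := by rw [← map_mul, (hxy i).2]
    rw [map_mul, map_mul, e1]
    calc _ = (x i * oneS) * oneS * (β g (y i) * β g oneS) := by ring
      _ = _ := by rw [(hxy i).1, (hxy i).1, e2]
  have hp1 : ∑ i, x i * y i = oneS := by
    have := hg1 1 rfl
    rw [key] at this
    simpa using this
  have hp : ∀ g : G, g ≠ 1 → ∑ i, x i * β g (y i) = 0 := fun g hg => by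
    rw [← key]; exact hgne g hg
  -- global coordinates
  obtain ⟨c, hc⟩ := hglob 1
  let X : G × Fin n → T := fun p => β p.1 (c p.1 * x p.2)
  let Y : G × Fin n → T := fun p => β p.1 (y p.2)
  have hXYg : ∀ g : G, ∑ p, X p * β g (Y p)
      = ∑ k : G, β k (c k * ∑ i, x i * β (k⁻¹ * g * k) (y i)) := by
    intro g
    rw [Fintype.sum_prod_type]
    refine Finset.sum_congr rfl fun k _ => ?_
    rw [Finset.mul_sum, map_sum]
    refine Finset.sum_congr rfl fun i _ => ?_
    have : β g (β k (y i)) = β k (β (k⁻¹ * g * k) (y i)) := by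
      rw [← RingAut.mul_apply, ← RingAut.mul_apply, ← map_mul, ← map_mul]
      congr 2; group
    simp only [X, Y]
    rw [this, ← map_mul, mul_assoc]
  have hXY1 : ∑ p, X p * Y p = 1 := by
    have := hXYg 1
    simp only [map_one, RingAut.one_apply, mul_one, inv_mul_cancel, hp1] at this
    rw [this, ← hc]
  have hXY : ∀ g : G, g ≠ 1 → ∑ p, X p * β g (Y p) = 0 := by
    intro g hg
    rw [hXYg]
    refine Finset.sum_eq_zero fun k _ => ?_
    rw [hp, mul_zero, map_zero]
    intro hk
    apply hg
    have : g = k * (k⁻¹ * g * k) * k⁻¹ := by group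
    rw [this, hk]; group
  obtain ⟨d, hd⟩ := exists_trace_one β H X Y hXY1 hXY
  have hinv : ∀ (t : T) (g : G), g ∈ H → β g (∑ k : H, β k t) = ∑ k : H, β k t := by
    intro t g hg
    rw [map_sum]
    refine Fintype.sum_equiv (Equiv.mulLeft (⟨g, hg⟩ : H)) _ _ ?_
    intro k
    simp [map_mul]
  let U : G × Fin n → T := fun p => ∑ k : H, β k (d * X p)
  let V : G × Fin n → T := fun p => ∑ k : H, β k (Y p)
  have hUV : ∀ g : G, ∑ p, U p * β g (V p) = if g ∈ H then 1 else 0 := by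
    intro g
    have e1 : ∀ p, U p * β g (V p) =
        ∑ a : H, ∑ b : H, β a (d * (X p * β ((a : G)⁻¹ * g * b) (Y p))) := by
      intro p
      simp only [U, V]
      rw [map_sum, Finset.sum_mul_sum]
      refine Finset.sum_congr rfl fun a _ => Finset.sum_congr rfl fun b _ => ?_
      have : β g (β b (Y p)) = β a (β ((a : G)⁻¹ * g * b) (Y p)) := by
        generalize Y p = z
        rw [← RingAut.mul_apply, ← RingAut.mul_apply, ← map_mul, ← map_mul]
        congr 2; group
      rw [this, ← map_mul, mul_assoc]
    simp_rw [e1]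
    rw [Finset.sum_comm]
    have e2 : ∀ a : H, ∑ p, ∑ b : H, β a (d * (X p * β ((a : G)⁻¹ * g * b) (Y p)))
        = ∑ b : H, β a (d * ∑ p, X p * β ((a : G)⁻¹ * g * b) (Y p)) := by
      intro a
      rw [Finset.sum_comm]
      refine Finset.sum_congr rfl fun b _ => ?_
      rw [Finset.mul_sum, map_sum]
    simp_rw [e2]
    split_ifs with hg
    · rw [← hd]
      refine Finset.sum_congr rfl fun a _ => ?_
      rw [Finset.sum_eq_single ((⟨g, hg⟩ : H)⁻¹ * a)]
      · simp [hXY1]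
      · intro b _ hb
        rw [hXY, mul_zero, map_zero]
        intro hk
        apply hb
        apply Subtype.ext
        have : (b : G) = g⁻¹ * a * ((a : G)⁻¹ * g * b) := by group
        rw [this, hk]; simp
      · simp
    · refine Finset.sum_eq_zero fun a _ => Finset.sum_eq_zero fun b _ => ?_
      rw [hXY, mul_zero, map_zero]
      intro hk
      apply hg
      have : g = a * ((a : G)⁻¹ * g * b) * (b : G)⁻¹ := by group
      rw [this, hk, mul_one]
      exact H.mul_mem a.2 (H.inv_mem b.2)
  -- the idempotent `e_H`
  have hmem : ∀ i, h i ∈ H := fun i => by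
    have : h i ∈ Set.range h := ⟨i, rfl⟩
    rw [hrange] at this; exact this
  let σ : Fin (m + 1) ≃ H := Equiv.ofBijective (fun i => ⟨h i, hmem i⟩)
    ⟨fun i j hij => hinj (congrArg Subtype.val hij), fun k => by
      have : (k : G) ∈ Set.range h := by rw [hrange]; exact k.2
      obtain ⟨i, hi⟩ := this
      exact ⟨i, Subtype.ext hi⟩⟩
  have hpsi : psiH β oneS h oneS = 1 - ∏ k : H, (1 - β k oneS) := by
    have e1 : ∏ k : H, (1 - β k oneS) = ∏ i, (1 - β (h i) oneS) :=
      (Fintype.prod_equiv σ _ _ fun i => rfl).symm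
    rw [e1, Finset.prod_one_sub_ordered, sub_sub_cancel]
    unfold psiH eIdem
    refine Finset.sum_congr rfl fun i _ => ?_
    have : β (h i) oneS * β (h i) oneS = β (h i) oneS := by rw [← map_mul, honeS]
    linear_combination (∏ j ∈ Finset.univ.filter (fun j => j < i), (1 - β (h j) oneS)) * this
  set E := psiH β oneS h oneS with hE
  have hEinv : ∀ g ∈ H, β g E = E := by
    intro g hg
    rw [hpsi, map_sub, map_one, map_prod]
    congr 1
    refine Fintype.prod_equiv (Equiv.mulLeft (⟨g, hg⟩ : H)) _ _ ?_
    intro k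
    simp [map_mul]
  have hEe : E * oneS = oneS := by
    rw [hpsi, ← Finset.mul_prod_erase Finset.univ _ (Finset.mem_univ (1 : H))]
    simp only [OneMemClass.coe_one, map_one, RingAut.one_apply]
    linear_combination (∏ k ∈ Finset.univ.erase (1 : H), (1 - β k oneS)) * honeS
  have hpsit : ∀ t : T, (∀ g ∈ H, β g t = t) → psiH β oneS h (t * oneS) = t * E := by
    intro t ht
    rw [hE]
    unfold psiH
    rw [Finset.mul_sum]
    refine Finset.sum_congr rfl fun i _ => ?_
    rw [map_mul, ht _ (hmem i), mul_assoc]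
  have hconj : ∀ g : G, ∀ k ∈ H, β k (β g⁻¹ E) = β g⁻¹ E := by
    intro g k hk
    have : β k (β g⁻¹ E) = β g⁻¹ (β (g * k * g⁻¹) E) := by
      rw [← RingAut.mul_apply, ← RingAut.mul_apply, ← map_mul, ← map_mul]
      congr 2; group
    rw [this, hEinv _ (hN.conj_mem k hk g)]
  have hSinv : ∀ t : T, (∀ g ∈ H, β g t = t) → t * oneS ∈ SinvH β oneS H := by
    intro t ht
    refine ⟨by rw [mul_assoc, honeS], fun g hg => ?_⟩
    rw [map_mul, ht g hg]
    linear_combination (-(t * β g oneS)) * honeS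
  have hUinv : ∀ p, ∀ g ∈ H, β g (U p) = U p := fun p g hg => hinv _ g hg
  have hVinv : ∀ p, ∀ g ∈ H, β g (V p) = V p := fun p g hg => hinv _ g hg
  have hterm : ∀ (g : G) p, U p * oneS * aMapH β oneS h g (V p * oneS * tilde1 β oneS h g⁻¹)
      = U p * β g (V p) * (β g E * oneS) := by
    intro g p
    have e0 : V p * oneS * tilde1 β oneS h g⁻¹ = (V p * β g⁻¹ E) * oneS := by
      unfold tilde1
      rw [← hE]
      linear_combination (V p * β g⁻¹ E) * honeS
    have e1 : β g (β g⁻¹ E) = E := by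
      rw [← RingAut.mul_apply, ← map_mul, mul_inv_cancel, map_one, RingAut.one_apply]
    rw [e0]
    unfold aMapH
    rw [hpsit _ fun k hk => by rw [map_mul, hVinv p k hk, hconj g k hk], map_mul, map_mul, e1]
    linear_combination (U p * β g (V p) * β g E) * (E * honeS + hEe)
  have hsum : ∀ g : G, ∑ p, U p * oneS * aMapH β oneS h g (V p * oneS * tilde1 β oneS h g⁻¹)
      = (if g ∈ H then 1 else 0) * (β g E * oneS) := by
    intro g
    simp_rw [hterm]
    rw [← Finset.sum_mul, hUV]
  let τ := (Fintype.equivFin (G × Fin n)).symm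
  refine ⟨Fintype.card (G × Fin n), fun j => U (τ j) * oneS, fun j => V (τ j) * oneS,
    fun j => ⟨hSinv _ (hUinv _), hSinv _ (hVinv _)⟩, fun g hg => ?_, fun g hg => ?_⟩
  · rw [Equiv.sum_comp τ
      (fun p => U p * oneS * aMapH β oneS h g (V p * oneS * tilde1 β oneS h g⁻¹)), hsum,
      if_pos hg, one_mul, hEinv g hg, hEe]
  · rw [Equiv.sum_comp τ
      (fun p => U p * oneS * aMapH β oneS h g (V p * oneS * tilde1 β oneS h g⁻¹)), hsum,
      if_neg hg, zero_mul]
end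

section
/- Assume H is normal in G, that S is an α-partial Galois extension of ι(R) = S^α and S' is an α'-partial Galois extension of ι'(R) = S'^{α'}, and let f : T → T' be a ring isomorphism such that f(β_g(t)) = β'_g(f(t)) for all g ∈ G and t ∈ T, f(1_S) = 1_{S'}, and f(ι(r)) = ι'(r) for all r ∈ R. Then the map φ : S^{α_H} → S'^{α'_H}, φ(s) = f(ψ_H(s))·1_{S'}, is a well-defined ring isomorphism satisfying φ(ι(r)·s) = ι'(r)·φ(s) for all r ∈ R and s ∈ S^{α_H}, φ(D̃_{gH}) = D̃'_{gH} for all g ∈ G, and φ(α_{gH}(x)) = α'_{gH}(φ(x)) for all g ∈ G and x ∈ D̃_{g⁻¹H}; that is, (S^{α_H}, α_{G/H}) and (S'^{α'_H}, α'_{G/H}) are partially G/H-isomorphic. In particular (taking H = {1}) the map s ↦ f(s)·1_{S'} is a partial G-isomorphism of (S, α) onto (S', α'). -/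
open Finset

variable {T : Type*} [CommRing T] {G : Type*} [Group G]

theorem psiH_mul_oneS {T : Type*} [CommRing T] {G : Type*} [Group G]
    (β : G →* RingAut T) (oneS : T) (honeS : oneS * oneS = oneS) {m : ℕ}
    (h : Fin (m + 1) → G) (h1 : h 0 = 1) (t : T) :
    psiH β oneS h t * oneS = t * oneS := by
  have key : ∀ i : Fin m, eIdem β oneS h i.succ * oneS = 0 := by
    intro i
    have hz : (0 : Fin (m + 1)) ∈ Finset.univ.filter (fun j => j < i.succ) := by
      simp
    unfold eIdem
    rw [← Finset.mul_prod_erase _ _ hz, h1, map_one]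
    have : (1 - (1 : RingAut T) oneS) * oneS = 0 := by
      rw [RingAut.one_apply, sub_mul, one_mul, honeS, sub_self]
    linear_combination (∏ j ∈ (Finset.univ.filter (fun j => j < i.succ)).erase 0,
      (1 - β (h j) oneS)) * β (h i.succ) oneS * this
  have key0 : eIdem β oneS h 0 = oneS := by
    simp [eIdem, h1]
  unfold psiH
  rw [Fin.sum_univ_succ, add_mul, Finset.sum_mul, Finset.sum_eq_zero, key0, h1, map_one]
  · rw [RingAut.one_apply, add_zero, mul_assoc, honeS]
  · intro i _
    rw [mul_assoc, key, mul_zero]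

theorem map_psiH {T T' : Type*} [CommRing T] [CommRing T'] {G : Type*} [Group G]
    (β : G →* RingAut T) (β' : G →* RingAut T') (oneS : T) (oneS' : T') {m : ℕ}
    (h : Fin (m + 1) → G) (f : T ≃+* T')
    (hfβ : ∀ (g : G) (t : T), f (β g t) = β' g (f t)) (hfS : f oneS = oneS') (t : T) :
    f (psiH β oneS h t) = psiH β' oneS' h (f t) := by
  simp only [psiH, eIdem, map_sum, map_mul, map_prod, map_sub, map_one, hfβ, hfS]

/-- if `(T, β)` and `(T', β')` are globally `G`-isomorphic globalizations
of partial Galois extensions `(S, α)` and `(S', α')` of `R`, and `H` is normal in `G`,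
then `φ(s) = f(ψ_H(s))·1_{S'}` is a partial `G/H`-isomorphism of
`(S^{α_H}, α_{G/H})` onto `(S'^{α'_H}, α'_{G/H})`; in particular (`H = {1}`),
`(S, α)` and `(S', α')` are partially `G`-isomorphic. -/
theorem global_iso_implies_partial_quotient_iso
    {T T' R : Type*} [CommRing T] [CommRing T'] [CommRing R]
    {G : Type*} [Group G] [Fintype G]
    (β : G →* RingAut T) (β' : G →* RingAut T')
    (oneS : T) (oneS' : T') (honeS : oneS * oneS = oneS) (honeS' : oneS' * oneS' = oneS')
    (hglob : ∀ t : T, ∃ c : G → T, t = ∑ g : G, β g (c g * oneS))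
    (hglob' : ∀ t : T', ∃ c : G → T', t = ∑ g : G, β' g (c g * oneS'))
    (ι : R → T) (ι' : R → T')
    (hιadd : ∀ a b : R, ι (a + b) = ι a + ι b) (hιmul : ∀ a b : R, ι (a * b) = ι a * ι b)
    (hιone : ι 1 = oneS) (hιinj : Function.Injective ι)
    (hι'add : ∀ a b : R, ι' (a + b) = ι' a + ι' b)
    (hι'mul : ∀ a b : R, ι' (a * b) = ι' a * ι' b)
    (hι'one : ι' 1 = oneS') (hι'inj : Function.Injective ι')
    (hinv : Set.range ι = SinvH β oneS (⊤ : Subgroup G))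
    (hinv' : Set.range ι' = SinvH β' oneS' (⊤ : Subgroup G))
    (hGal : ∃ (n : ℕ) (x y : Fin n → T),
      (∀ i, x i * oneS = x i ∧ y i * oneS = y i) ∧
      (∀ g : G, g = 1 → ∑ i, x i * (β g (y i * (β g⁻¹ oneS * oneS)) * oneS) = oneS) ∧
      (∀ g : G, g ≠ 1 → ∑ i, x i * (β g (y i * (β g⁻¹ oneS * oneS)) * oneS) = 0))
    (hGal' : ∃ (n : ℕ) (x y : Fin n → T'),
      (∀ i, x i * oneS' = x i ∧ y i * oneS' = y i) ∧
      (∀ g : G, g = 1 →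
        ∑ i, x i * (β' g (y i * (β' g⁻¹ oneS' * oneS')) * oneS') = oneS') ∧
      (∀ g : G, g ≠ 1 →
        ∑ i, x i * (β' g (y i * (β' g⁻¹ oneS' * oneS')) * oneS') = 0))
    (H : Subgroup G) (hN : H.Normal) {m : ℕ} (h : Fin (m + 1) → G)
    (hinj : Function.Injective h) (hrange : Set.range h = (H : Set G)) (h1 : h 0 = 1)
    (f : T ≃+* T')
    (hfβ : ∀ (g : G) (t : T), f (β g t) = β' g (f t))
    (hfS : f oneS = oneS')
    (hfι : ∀ r : R, f (ι r) = ι' r) :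
    Set.BijOn (fun s => f (psiH β oneS h s) * oneS')
      (SinvH β oneS H) (SinvH β' oneS' H) ∧
    (∀ s ∈ SinvH β oneS H, ∀ t ∈ SinvH β oneS H,
      f (psiH β oneS h (s + t)) * oneS' =
        f (psiH β oneS h s) * oneS' + f (psiH β oneS h t) * oneS' ∧
      f (psiH β oneS h (s * t)) * oneS' =
        (f (psiH β oneS h s) * oneS') * (f (psiH β oneS h t) * oneS')) ∧
    (∀ r : R, ∀ s ∈ SinvH β oneS H,
      f (psiH β oneS h (ι r * s)) * oneS' = ι' r * (f (psiH β oneS h s) * oneS')) ∧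
    (∀ g : G, (fun s => f (psiH β oneS h s) * oneS') '' DtH β oneS H h g =
      DtH β' oneS' H h g) ∧
    (∀ g : G, ∀ x ∈ DtH β oneS H h g⁻¹,
      f (psiH β oneS h (aMapH β oneS h g x)) * oneS' =
        aMapH β' oneS' h g (f (psiH β oneS h x) * oneS')) := by
  have hφ : ∀ s : T, f (psiH β oneS h s) * oneS' = f (s * oneS) := by
    intro s
    rw [← hfS, ← map_mul, psiH_mul_oneS β oneS honeS h h1]
  have hψ := map_psiH β β' oneS oneS' h f hfβ hfS
  have htil : ∀ g, f (tilde1 β oneS h g) = tilde1 β' oneS' h g := by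
    intro g
    simp only [tilde1, map_mul, hfβ, hψ, hfS]
  have hmem : ∀ s : T, f s ∈ SinvH β' oneS' H ↔ s ∈ SinvH β oneS H := by
    intro s
    simp only [SinvH, Set.mem_setOf_eq, ← hfS, ← hfβ, ← map_mul, f.injective.eq_iff]
  have hD : ∀ g, ∀ x ∈ DtH β oneS H h g, x * oneS = x := by
    rintro g _ ⟨s, hs, rfl⟩
    show s * _ * oneS = s * _
    have := hs.1
    linear_combination tilde1 β oneS h g * this
  simp only [hφ]
  refine ⟨⟨?_, ?_, ?_⟩, ?_, ?_, ?_, ?_⟩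
  · intro s hs
    show f (s * oneS) ∈ _
    rw [hs.1]
    exact (hmem s).2 hs
  · intro s hs t ht hst
    have hst' : f (s * oneS) = f (t * oneS) := hst
    rw [hs.1, ht.1] at hst'
    exact f.injective hst'
  · intro s' hs'
    obtain ⟨s, rfl⟩ := f.surjective s'
    have hs := (hmem s).1 hs'
    exact ⟨s, hs, congrArg f hs.1⟩
  · intro s hs t ht
    rw [add_mul, map_add, ← map_mul]
    refine ⟨rfl, ?_⟩
    rw [hs.1, mul_assoc]
  · intro r s hs
    rw [mul_assoc, map_mul, hfι]
  · intro g
    ext x'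
    constructor
    · rintro ⟨x, hx, rfl⟩
      show f (x * oneS) ∈ _
      rw [hD g x hx]
      obtain ⟨s, hs, rfl⟩ := hx
      exact ⟨f s, (hmem s).2 hs, by simp only [map_mul, htil]⟩
    · rintro ⟨s', hs', rfl⟩
      obtain ⟨s, rfl⟩ := f.surjective s'
      have hx : s * tilde1 β oneS h g ∈ DtH β oneS H h g := ⟨s, (hmem s).1 hs', rfl⟩
      refine ⟨_, hx, ?_⟩
      show f (_ * oneS) = _
      rw [hD g _ hx, map_mul, htil]
  · intro g x hx
    rw [hD _ x hx]
    simp only [aMapH, map_mul, hfβ, hψ, hfS]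
    rw [mul_assoc, honeS']
end

section
/- For every g ∈ G the following identities hold: β_g(e_H)·1_S = 1_g + Σ_{i=2}^{m} (∏_{j=2}^{i} (1_S − 1_{g h_{j−1}}))·1_{g h_i}, and for every x ∈ S, β_g(ψ_H(x))·1_S = α_g(x·1_{g⁻¹}) + Σ_{i=2}^{m} (∏_{j=1}^{i−1} (1_S − 1_{g h_j}))·α_{g h_i}(x·1_{(g h_i)⁻¹}). -/
open Finset

variable {T : Type*} [CommRing T] {G : Type*} [Group G]

theorem aux_prod {T : Type*} [CommRing T] {ι : Type*} [DecidableEq ι] (e : T) (he : e * e = e)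
    (a : ι → T) (s : Finset ι) :
    (∏ j ∈ s, (1 - a j)) * e = (∏ j ∈ s, (e - a j * e)) * e := by
  induction s using Finset.induction_on with
  | empty => simp
  | insert i s hi ih =>
    rw [Finset.prod_insert hi, Finset.prod_insert hi]
    calc (1 - a i) * (∏ j ∈ s, (1 - a j)) * e
        = (1 - a i) * ((∏ j ∈ s, (1 - a j)) * e) := by ring
      _ = (1 - a i) * ((∏ j ∈ s, (e - a j * e)) * (e * e)) := by rw [ih, he]
      _ = _ := by ring

theorem aux_main {T : Type*} [CommRing T] {G : Type*} [Group G]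
    (β : G →* RingAut T) (e : T) (he : e * e = e) {m : ℕ} (h : Fin (m + 1) → G)
    (h1 : h 0 = 1) (g : G) (x : T) (hx : x * e = x) :
    β g (psiH β e h x) * e = β g x * e +
      ∑ i ∈ Finset.univ.filter (fun i : Fin (m + 1) => 0 < i),
        (∏ j ∈ Finset.univ.filter (fun j => j < i), (e - β (g * h j) e * e)) *
          (β (g * h i) x * e) := by
  have key : β g (psiH β e h x) * e = ∑ i : Fin (m + 1),
      (∏ j ∈ Finset.univ.filter (fun j => j < i), (e - β (g * h j) e * e)) *
          (β (g * h i) x * e) := by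
    unfold psiH eIdem
    rw [map_sum, Finset.sum_mul]
    refine Finset.sum_congr rfl fun i _ => ?_
    have hm : ∀ (k : G) (y : T), β g (β k y) = β (g * k) y := fun k y => by
      rw [map_mul]; rfl
    have hxx : β (g * h i) x * β (g * h i) e = β (g * h i) x := by
      rw [← map_mul, hx]
    have hp := aux_prod e he (fun j => β (g * h j) e) (Finset.univ.filter (fun j => j < i))
    simp only [map_mul (β g), map_prod, map_sub, map_one (β g), hm]
    simp only [map_mul β, RingAut.mul_apply] at hp hxx ⊢
    linear_combination (β g (β (h i) x)) * hp + (∏ j ∈ Finset.univ.filter (fun j => j < i), (1 - β g (β (h j) e))) * e * hxx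
  rw [key, ← Finset.add_sum_erase _ _ (Finset.mem_univ (0 : Fin (m + 1)))]
  congr 1
  · simp [h1]
  · refine Finset.sum_congr ?_ fun _ _ => rfl
    ext i
    simp [Fin.pos_iff_ne_zero]

theorem aux_alpha_s14 {T : Type*} [CommRing T] {G : Type*} [Group G]
    (β : G →* RingAut T) (e : T) (he : e * e = e) (k : G) (x : T) (hx : x * e = x) :
    β k (x * (β k⁻¹ e * e)) * e = β k x * e := by
  have h2 : β k (β k⁻¹ e) = e := by
    rw [← RingAut.mul_apply, ← map_mul]; simp
  have h3 : x * (β k⁻¹ e * e) = x * β k⁻¹ e := by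
    linear_combination (β k⁻¹ e) * hx
  rw [h3, map_mul, h2, mul_assoc, he]

/-- the explicit formulas for `1̃_{gH} = β_g(e_H)·1_S` and for
`α_{gH}(x) = β_g(ψ_H(x))·1_S` (for `x ∈ S`) in terms of the idempotents
`1_g = β_g(1_S)·1_S` and the partial isomorphisms `α_g(x·1_{g⁻¹}) = β_g(x·1_{g⁻¹})·1_S`. -/
theorem tilde1_and_aMapH_formulas {T : Type*} [CommRing T] {G : Type*} [Group G]
    [Fintype G]
    (β : G →* RingAut T) (oneS : T) (honeS : oneS * oneS = oneS)
    (H : Subgroup G) {m : ℕ} (h : Fin (m + 1) → G)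
    (hinj : Function.Injective h) (hrange : Set.range h = (H : Set G))
    (h1 : h 0 = 1) :
    (∀ g : G, β g (psiH β oneS h oneS) * oneS =
      β g oneS * oneS +
        ∑ i ∈ Finset.univ.filter (fun i : Fin (m + 1) => 0 < i),
          (∏ j ∈ Finset.univ.filter (fun j => j < i), (oneS - β (g * h j) oneS * oneS)) *
            (β (g * h i) oneS * oneS)) ∧
    (∀ (g : G) (x : T), x * oneS = x →
      β g (psiH β oneS h x) * oneS =
        β g (x * (β g⁻¹ oneS * oneS)) * oneS +
          ∑ i ∈ Finset.univ.filter (fun i : Fin (m + 1) => 0 < i),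
            (∏ j ∈ Finset.univ.filter (fun j => j < i), (oneS - β (g * h j) oneS * oneS)) *
              (β (g * h i) (x * (β (g * h i)⁻¹ oneS * oneS)) * oneS)) := by
  refine ⟨fun g => aux_main β oneS honeS h h1 g oneS honeS, fun g x hx => ?_⟩
  rw [aux_main β oneS honeS h h1 g x hx]
  simp only [aux_alpha_s14 β oneS honeS _ x hx]
end

section
/- Let G be a finite abelian group, let α and α' be unital partial actions of G on commutative rings S and S', both partial Galois extensions of a common subring R with the same identity element, R = S^α = S'^{α'}, and let H = {h_1 = 1, h_2, …, h_m} be a subgroup of G with a fixed enumeration. If f : S → S' is a ring isomorphism with f(r) = r for all r ∈ R, f(S_g) ⊆ S'_g for all g ∈ G, and f(α_g(x)) = α'_g(f(x)) for all x ∈ S_{g⁻¹} (a partial G-isomorphism), then f(S^{α_H}) = S'^{α'_H}, f(1̃_{gH}) = 1̃'_{gH} for all g ∈ G, and f(α_{gH}(x)) = α'_{gH}(f(x)) for all g ∈ G and all x ∈ S^{α_H}·1̃_{g⁻¹H}; that is, f restricts to a partial G/H-isomorphism of (S^{α_H}, α_{G/H}) onto (S'^{α'_H}, α'_{G/H}).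 -/
open Finset

/-- A unital partial action `α = (S_g, α_g)_{g∈G}` of a group `G` on a commutative
ring `S`: idempotents `1_g = E g` with `1_1 = 1`, ideals `S_g = S·1_g` (encoded as
`{x : S | x * E g = x}`), and ring isomorphisms `α_g = act g : S_{g⁻¹} → S_g`
satisfying the axioms of a partial action. -/
structure UnitalPartialAction (G : Type*) [Group G] (S : Type*) [CommRing S] where
  E : G → S
  act : G → S → S
  idem : ∀ g, E g * E g = E g
  E_one : E 1 = 1
  act_one : ∀ s, act 1 s = s
  mapsTo : ∀ g x, x * E g⁻¹ = x → act g x * E g = act g x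
  map_add : ∀ g x y, x * E g⁻¹ = x → y * E g⁻¹ = y → act g (x + y) = act g x + act g y
  map_mul : ∀ g x y, x * E g⁻¹ = x → y * E g⁻¹ = y → act g (x * y) = act g x * act g y
  act_inv_act : ∀ g x, x * E g⁻¹ = x → act g⁻¹ (act g x) = x
  image_eq : ∀ g l, act g '' {x | x * E g⁻¹ = x ∧ x * E l = x} =
    {x | x * E g = x ∧ x * E (g * l) = x}
  act_act : ∀ g l x, x * E l⁻¹ = x → x * E (g * l)⁻¹ = x →
    act g (act l x) = act (g * l) x

/-- The subring of invariants `S^α`. -/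
def UnitalPartialAction.invariants {G : Type*} [Group G] {S : Type*} [CommRing S]
    (α : UnitalPartialAction G S) : Set S :=
  {s : S | ∀ g : G, α.act g (s * α.E g⁻¹) = s * α.E g}

/-- `S` is an `α`-partial Galois extension of `S^α`: there exist partial Galois
coordinates `x_i, y_i` with `Σ_i x_i·α_g(y_i·1_{g⁻¹}) = δ_{1,g}`. -/
def UnitalPartialAction.IsPartialGalois {G : Type*} [Group G] {S : Type*} [CommRing S]
    (α : UnitalPartialAction G S) : Prop :=
  ∃ (n : ℕ) (x y : Fin n → S),
    (∀ g : G, g = 1 → ∑ i, x i * α.act g (y i * α.E g⁻¹) = 1) ∧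
    (∀ g : G, g ≠ 1 → ∑ i, x i * α.act g (y i * α.E g⁻¹) = 0)


/-- The invariants `S^{α_H}` of `S` under the restriction of `α` to a subgroup `H`. -/
def UnitalPartialAction.invariantsH {G : Type*} [Group G] {S : Type*} [CommRing S]
    (α : UnitalPartialAction G S) (H : Subgroup G) : Set S :=
  {s : S | ∀ g ∈ H, α.act g (s * α.E g⁻¹) = s * α.E g}

/-- The idempotent `1̃_{gH} = 1_g + Σ_{i=2}^{m} (∏_{j=2}^{i} (1_S − 1_{gh_{j−1}}))·1_{gh_i}`
(0-based indexing with `h 0 = 1`). -/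
def tilde1A {G : Type*} [Group G] {S : Type*} [CommRing S]
    (α : UnitalPartialAction G S) {m : ℕ} (h : Fin (m + 1) → G) (g : G) : S :=
  α.E g + ∑ i ∈ Finset.univ.filter (fun i : Fin (m + 1) => 0 < i),
    (∏ j ∈ Finset.univ.filter (fun j => j < i), (1 - α.E (g * h j))) * α.E (g * h i)

/-- The map `α_{gH}(x) = α_g(x·1_{g⁻¹}) +
Σ_{i=2}^{m} (∏_{j=1}^{i−1} (1_S − 1_{gh_j}))·α_{gh_i}(x·1_{(gh_i)⁻¹})`. -/
def aMapHA {G : Type*} [Group G] {S : Type*} [CommRing S]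
    (α : UnitalPartialAction G S) {m : ℕ} (h : Fin (m + 1) → G) (g : G) (x : S) : S :=
  α.act g (x * α.E g⁻¹) + ∑ i ∈ Finset.univ.filter (fun i : Fin (m + 1) => 0 < i),
    (∏ j ∈ Finset.univ.filter (fun j => j < i), (1 - α.E (g * h j))) *
      α.act (g * h i) (x * α.E (g * h i)⁻¹)


namespace UnitalPartialAction
variable {G : Type*} [Group G] {S : Type*} [CommRing S] (α : UnitalPartialAction G S)

/-- The everywhere defined map `s ↦ α_g(s·1_{g⁻¹})`. -/
def bet (g : G) (s : S) : S := α.act g (s * α.E g⁻¹)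

theorem act_EE (g l : G) : α.act g (α.E g⁻¹ * α.E l) = α.E g * α.E (g * l) := by
  have i1 := α.idem g
  have i2 := α.idem (g * l)
  have i3 := α.idem g⁻¹
  have i4 := α.idem l
  have hm : α.E g * α.E (g * l) ∈ {x | x * α.E g = x ∧ x * α.E (g * l) = x} :=
    ⟨by linear_combination α.E (g * l) * i1, by linear_combination α.E g * i2⟩
  rw [← α.image_eq] at hm
  obtain ⟨u, ⟨hu1, hu2⟩, hu⟩ := hm
  have hp1 : (α.E g⁻¹ * α.E l) * α.E g⁻¹ = α.E g⁻¹ * α.E l := by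
    linear_combination α.E l * i3
  have hp2 : (α.E g⁻¹ * α.E l) * α.E l = α.E g⁻¹ * α.E l := by
    linear_combination α.E g⁻¹ * i4
  have hq : α.act g (α.E g⁻¹ * α.E l) ∈ {x | x * α.E g = x ∧ x * α.E (g * l) = x} := by
    rw [← α.image_eq]
    exact ⟨_, ⟨hp1, hp2⟩, rfl⟩
  obtain ⟨hq1, hq2⟩ := hq
  have hmul := α.map_mul g u _ hu1 hp1
  have hup : u * (α.E g⁻¹ * α.E l) = u := by rw [← mul_assoc, hu1, hu2]
  rw [hup, hu] at hmul
  rw [hmul, mul_comm (α.E g * _), ← mul_assoc, hq1, hq2]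

theorem bet_one (g : G) : α.bet g 1 = α.E g := by
  have := α.act_EE g 1
  simpa [bet, α.E_one, α.idem] using this

theorem bet_dom (g : G) (s : S) : s * α.E g⁻¹ * α.E g⁻¹ = s * α.E g⁻¹ := by
  rw [mul_assoc, α.idem]

theorem bet_E (g : G) (s : S) : α.bet g s * α.E g = α.bet g s :=
  α.mapsTo g _ (α.bet_dom g s)

theorem bet_add (g : G) (s t : S) : α.bet g (s + t) = α.bet g s + α.bet g t := by
  unfold bet
  rw [← α.map_add g _ _ (α.bet_dom g s) (α.bet_dom g t), add_mul]

theorem bet_mul (g : G) (s t : S) : α.bet g (s * t) = α.bet g s * α.bet g t := by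
  unfold bet
  rw [← α.map_mul g _ _ (α.bet_dom g s) (α.bet_dom g t)]
  congr 1
  linear_combination (-s * t) * α.idem g⁻¹

/-- `bet g` as an additive homomorphism. -/
def betHom (g : G) : S →+ S := AddMonoidHom.mk' (α.bet g) (α.bet_add g)

theorem bet_zero (g : G) : α.bet g 0 = 0 := _root_.map_zero (α.betHom g)

theorem bet_sum (g : G) {ι : Type*} (s : Finset ι) (F : ι → S) :
    α.bet g (∑ i ∈ s, F i) = ∑ i ∈ s, α.bet g (F i) := _root_.map_sum (α.betHom g) F s

theorem bet_bet (g l : G) (s : S) : α.bet g (α.bet l s) = α.bet (g * l) s * α.E g := by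
  have i1 := α.idem l⁻¹
  have i2 := α.idem (g * l)⁻¹
  have e1 := α.act_EE l (g * l)⁻¹
  have e2 := α.act_EE (g * l) l⁻¹
  have hl : l * (g * l)⁻¹ = g⁻¹ := by group
  have hg : g * l * l⁻¹ = g := by group
  rw [hl] at e1
  rw [hg] at e2
  have d1 : (α.E l⁻¹ * α.E (g * l)⁻¹) * α.E l⁻¹ = α.E l⁻¹ * α.E (g * l)⁻¹ := by
    linear_combination α.E (g * l)⁻¹ * i1
  have d2 : (α.E (g * l)⁻¹ * α.E l⁻¹) * α.E (g * l)⁻¹ = α.E (g * l)⁻¹ * α.E l⁻¹ := by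
    linear_combination α.E l⁻¹ * i2
  have a1 := α.map_mul l _ _ (α.bet_dom l s) d1
  have a2 := α.map_mul (g * l) _ _ (α.bet_dom (g * l) s) d2
  have s1 : s * α.E l⁻¹ * (α.E l⁻¹ * α.E (g * l)⁻¹) = s * α.E l⁻¹ * α.E (g * l)⁻¹ := by
    linear_combination s * α.E (g * l)⁻¹ * i1
  have s2 : s * α.E (g * l)⁻¹ * (α.E (g * l)⁻¹ * α.E l⁻¹) = s * α.E l⁻¹ * α.E (g * l)⁻¹ := by
    linear_combination s * α.E l⁻¹ * i2
  rw [s1, e1] at a1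
  rw [s2, e2] at a2
  change _ = α.bet l s * _ at a1
  change _ = α.bet (g * l) s * _ at a2
  rw [← mul_assoc, bet_E] at a1 a2
  have := α.act_act g l (s * α.E l⁻¹ * α.E (g * l)⁻¹)
    (by linear_combination s * α.E (g * l)⁻¹ * i1) (by linear_combination s * α.E l⁻¹ * i2)
  rw [a1, a2] at this
  exact this

theorem trace_mem [Fintype G] (s : S) : ∑ l, α.bet l s ∈ α.invariants := by
  intro g
  change α.bet g _ = _
  rw [bet_sum, Finset.sum_mul]
  simp_rw [bet_bet]
  exact Fintype.sum_equiv (Equiv.mulLeft g) _ _ (fun _ => rfl)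

/-- orthogonality of Galois coordinates -/
theorem orth {n : ℕ} {x y : Fin n → S}
    (h0 : ∀ g : G, g ≠ 1 → ∑ i, x i * α.act g (y i * α.E g⁻¹) = 0)
    (g k : G) (hk : k ≠ g) : ∑ i, α.bet g (x i) * α.bet k (y i) = 0 := by
  have h2 := h0 (g⁻¹ * k) (fun h => hk (inv_mul_eq_one.mp h).symm)
  have h3 := congrArg (α.bet g) h2
  rw [bet_zero, bet_sum] at h3
  rw [← h3]
  refine Finset.sum_congr rfl fun i _ => ?_
  rw [bet_mul]
  change _ = _ * α.bet g (α.bet _ _)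
  rw [bet_bet, mul_inv_cancel_left, mul_comm (α.bet k _), ← mul_assoc, bet_E]

end UnitalPartialAction

open UnitalPartialAction in
theorem map_E_eq {G : Type*} [Group G] [Fintype G] {S S' : Type*} [CommRing S] [CommRing S']
    (α : UnitalPartialAction G S) (α' : UnitalPartialAction G S')
    (hGal : α.IsPartialGalois) (hGal' : α'.IsPartialGalois) (f : S ≃+* S')
    (hinv : ∀ s ∈ α.invariants, f s ∈ α'.invariants)
    (hfdom : ∀ (g : G) (x : S), x * α.E g = x → f x * α'.E g = f x)
    (hfact : ∀ (g : G) (x : S), x * α.E g⁻¹ = x → f (α.act g x) = α'.act g (f x))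
    (g : G) : f (α.E g) = α'.E g := by
  classical
  have hrel : ∀ k s, f (α.bet k s) = α'.bet k (f s) * f (α.E k) := by
    intro k s
    have hE : f (α.E k⁻¹) * α'.E k⁻¹ = f (α.E k⁻¹) := hfdom _ _ (α.idem _)
    have h1 : ∀ t, f (α.bet k t) = α'.bet k (f t * f (α.E k⁻¹)) := by
      intro t
      unfold bet
      rw [hfact _ _ (α.bet_dom k t), _root_.map_mul, mul_assoc, hE]
    have h2 := h1 1
    rw [bet_one, map_one, one_mul] at h2
    rw [h1, bet_mul, ← h2]
  obtain ⟨n, x, y, hx1, hx0⟩ := hGal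
  obtain ⟨n', x', y', hx1', hx0'⟩ := hGal'
  have hdec : ∀ s, s = ∑ i, x i * ∑ k, α.bet k (y i * s) := by
    intro s
    simp_rw [Finset.mul_sum]
    rw [Finset.sum_comm]
    have : ∀ k, ∑ i, x i * α.bet k (y i * s) = if k = 1 then s else 0 := by
      intro k
      simp_rw [bet_mul, ← mul_assoc]
      rw [← Finset.sum_mul]
      split_ifs with hk
      · have := hx1 k hk
        unfold bet
        rw [this, hk]
        simp [α.E_one, α.act_one]
      · have := hx0 k hk
        unfold bet
        rw [this, zero_mul]
    simp [this]
  have hb : ∀ s, α'.bet g (f s) = ∑ k, (∑ i, α'.bet g (f (x i)) * α'.bet k (f (y i))) *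
      (f (α.E k) * α'.E g) * α'.bet k (f s) := by
    intro s
    conv_lhs => rw [hdec s]
    rw [map_sum, bet_sum]
    simp_rw [Finset.sum_mul]
    rw [Finset.sum_comm]
    refine Finset.sum_congr rfl fun i _ => ?_
    have hi := hinv _ (α.trace_mem (y i * s)) g
    change α'.bet g _ = _ at hi
    rw [_root_.map_mul, bet_mul, hi, map_sum, Finset.sum_mul, Finset.mul_sum]
    refine Finset.sum_congr rfl fun k _ => ?_
    rw [hrel, _root_.map_mul, bet_mul]
    ring
  have h1 : ∑ j, α'.bet g (x' j) * α'.bet g (y' j) = α'.E g := by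
    have := hx1' 1 rfl
    simp only [inv_one, α'.E_one, mul_one, α'.act_one] at this
    simp_rw [← bet_mul]
    rw [← bet_sum, this, bet_one]
  have key : ∃ c, α'.E g = c * f (α.E g) := by
    refine ⟨(∑ i, α'.bet g (f (x i)) * α'.bet g (f (y i))) * α'.E g * α'.E g, ?_⟩
    conv_lhs => rw [← h1]
    have hj : ∀ j, α'.bet g (y' j) = ∑ k, (∑ i, α'.bet g (f (x i)) * α'.bet k (f (y i))) *
      (f (α.E k) * α'.E g) * α'.bet k (y' j) := fun j => by
      have := hb (f.symm (y' j))
      rw [f.apply_symm_apply] at this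
      exact this
    calc _ = ∑ j, ∑ k, α'.bet g (x' j) *
        ((∑ i, α'.bet g (f (x i)) * α'.bet k (f (y i))) *
          (f (α.E k) * α'.E g) * α'.bet k (y' j)) :=
          Finset.sum_congr rfl fun j _ => by rw [hj j, Finset.mul_sum]
      _ = ∑ k, (∑ i, α'.bet g (f (x i)) * α'.bet k (f (y i))) *
      (f (α.E k) * α'.E g) * ∑ j, α'.bet g (x' j) * α'.bet k (y' j) := by
          rw [Finset.sum_comm]
          refine Finset.sum_congr rfl fun k _ => ?_
          rw [Finset.mul_sum]
          refine Finset.sum_congr rfl fun j _ => ?_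
          ring
      _ = _ := by
          rw [Finset.sum_eq_single g]
          · rw [h1]; ring
          · intro k _ hk
            rw [α'.orth hx0' g k hk, mul_zero]
          · simp
  obtain ⟨c, hc⟩ := key
  have hi : f (α.E g) * f (α.E g) = f (α.E g) := by rw [← _root_.map_mul, α.idem]
  have hd := hfdom g _ (α.idem g)
  rw [← hd, hc]
  linear_combination c * hi

/-- a partial `G`-isomorphism `f : (S, α) → (S', α')` of partial Galois
extensions of `R` restricts to a partial `G/H`-isomorphism of `(S^{α_H}, α_{G/H})`
onto `(S'^{α'_H}, α'_{G/H})`. -/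
theorem partial_iso_restricts_to_quotient {G : Type*} [CommGroup G] [Fintype G]
    {R S S' : Type*} [CommRing R] [CommRing S] [CommRing S']
    [Algebra R S] [Algebra R S']
    (hRinj : Function.Injective (algebraMap R S))
    (hRinj' : Function.Injective (algebraMap R S'))
    (α : UnitalPartialAction G S) (α' : UnitalPartialAction G S')
    (hinv : α.invariants = Set.range (algebraMap R S))
    (hinv' : α'.invariants = Set.range (algebraMap R S'))
    (hGal : α.IsPartialGalois) (hGal' : α'.IsPartialGalois)
    (H : Subgroup G) {m : ℕ} (h : Fin (m + 1) → G)
    (hinj : Function.Injective h) (hrange : Set.range h = (H : Set G)) (h1 : h 0 = 1)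
    (f : S ≃+* S')
    (hfR : ∀ r : R, f (algebraMap R S r) = algebraMap R S' r)
    (hfdom : ∀ (g : G) (x : S), x * α.E g = x → f x * α'.E g = f x)
    (hfact : ∀ (g : G) (x : S), x * α.E g⁻¹ = x → f (α.act g x) = α'.act g (f x)) :
    f '' α.invariantsH H = α'.invariantsH H ∧
    (∀ g : G, f (tilde1A α h g) = tilde1A α' h g) ∧
    (∀ g : G, ∀ x ∈ (fun s => s * tilde1A α h g⁻¹) '' α.invariantsH H,
      f (aMapHA α h g x) = aMapHA α' h g (f x)) := by
  classical
  have hE : ∀ g, f (α.E g) = α'.E g := by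
    refine map_E_eq α α' hGal hGal' f ?_ hfdom hfact
    intro s hs
    rw [hinv] at hs
    obtain ⟨r, rfl⟩ := hs
    rw [hfR, hinv']
    exact ⟨r, rfl⟩
  have hB : ∀ g s, f (α.act g (s * α.E g⁻¹)) = α'.act g (f s * α'.E g⁻¹) := by
    intro g s
    rw [hfact _ _ (α.bet_dom g s), map_mul, hE]
  refine ⟨?_, ?_, ?_⟩
  · ext t
    constructor
    · rintro ⟨s, hs, rfl⟩ g hg
      rw [← hB, hs g hg, map_mul, hE]
    · intro ht
      refine ⟨f.symm t, fun g hg => f.injective ?_, f.apply_symm_apply t⟩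
      rw [hB, map_mul, hE, f.apply_symm_apply]
      exact ht g hg
  · intro g
    simp only [tilde1A, map_add, map_sum, map_mul, map_prod, map_sub, map_one, hE]
  · intro g x _
    simp only [aMapHA, map_add, map_sum, map_mul, map_prod, map_sub, map_one, hE, hB]
end

section
/- Let G be a finite abelian group and α a unital partial action of G on the commutative ring S. On the product ring P = ∏_{g∈G} S_g define, for (l,t) ∈ G×G, the ideals P_{(l,t)} = ∏_{g∈G} S_g·1_l·1_{t⁻¹g} and the maps α̂_{(l,t)} : P_{(l⁻¹,t⁻¹)} → P_{(l,t)} given coordinatewise by (α̂_{(l,t)}((x_g)_{g∈G}))_μ = α_l(x_{(lt)⁻¹μ}) for μ ∈ G (note each coordinate x_g of an element of P_{(l⁻¹,t⁻¹)} lies in S·1_{l⁻¹}, so α_l applies; equivalently, for elements of the form (d_g·1_{l⁻¹}·1_{tg})_{g∈G}, the (ltg)-th coordinate of the image is α_l(d_g·1_{l⁻¹})·1_{ltg}). Then α̂ = (P_{(l,t)}, α̂_{(l,t)})_{(l,t)∈G×G} is a unital partial action of G×G on P: each α̂_{(l,t)} is a well-defined ring isomorphism of P_{(l⁻¹,t⁻¹)}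 onto P_{(l,t)}, α̂_{(1,1)} = id_P, α̂_{(l,t)}(P_{(l,t)⁻¹} ∩ P_{(l',t')}) = P_{(l,t)} ∩ P_{(ll',tt')}, and α̂_{(l,t)}(α̂_{(l',t')}(x)) = α̂_{(ll',tt')}(x) for all x ∈ P_{(l',t')⁻¹} ∩ P_{((ll',tt'))⁻¹}. -/
open Finset

/-- The product ring `P = ∏_{g∈G} S_g`, realized inside the full product `G → S` as
the set of tuples `x` with `x g ∈ S_g` for all `g`. -/
def PsetA {G : Type*} [Group G] {S : Type*} [CommRing S]
    (α : UnitalPartialAction G S) : Set (G → S) :=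
  {x : G → S | ∀ g : G, x g * α.E g = x g}

/-- The ideal `P_{(l,t)} = ∏_{g∈G} S_g·1_l·1_{t⁻¹g}` of `P`. -/
def PdomA {G : Type*} [Group G] {S : Type*} [CommRing S]
    (α : UnitalPartialAction G S) (l t : G) : Set (G → S) :=
  {x : G → S | ∀ g : G, x g * (α.E g * α.E l * α.E (t⁻¹ * g)) = x g}

/-- The map `α̂_{(l,t)}`, given coordinatewise by `(α̂_{(l,t)}(x))_μ = α_l(x_{(lt)⁻¹μ})`. -/
def hatActA {G : Type*} [Group G] {S : Type*} [CommRing S]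
    (α : UnitalPartialAction G S) (l t : G) (x : G → S) : G → S :=
  fun μ => α.act l (x ((l * t)⁻¹ * μ))

theorem mem_PdomA_iff {G : Type*} [Group G] {S : Type*} [CommRing S]
    (α : UnitalPartialAction G S) (l t : G) (x : G → S) :
    x ∈ PdomA α l t ↔
      ∀ g, x g * α.E g = x g ∧ x g * α.E l = x g ∧ x g * α.E (t⁻¹ * g) = x g := by
  refine forall_congr' fun g => ⟨fun h => ?_, fun ⟨h1, h2, h3⟩ => ?_⟩
  · have i1 := α.idem g
    have i2 := α.idem l
    have i3 := α.idem (t⁻¹ * g)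
    refine ⟨?_, ?_, ?_⟩
    · calc x g * α.E g = x g * (α.E g * α.E l * α.E (t⁻¹ * g)) * α.E g := by rw [h]
        _ = x g * ((α.E g * α.E g) * α.E l * α.E (t⁻¹ * g)) := by ring
        _ = x g := by rw [i1, h]
    · calc x g * α.E l = x g * (α.E g * α.E l * α.E (t⁻¹ * g)) * α.E l := by rw [h]
        _ = x g * (α.E g * (α.E l * α.E l) * α.E (t⁻¹ * g)) := by ring
        _ = x g := by rw [i2, h]
    · calc x g * α.E (t⁻¹ * g)
          = x g * (α.E g * α.E l * α.E (t⁻¹ * g)) * α.E (t⁻¹ * g) := by rw [h]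
        _ = x g * (α.E g * α.E l * (α.E (t⁻¹ * g) * α.E (t⁻¹ * g))) := by ring
        _ = x g := by rw [i3, h]
  · rw [← mul_assoc, ← mul_assoc, h1, h2, h3]

theorem act_mem_aux {G : Type*} [Group G] {S : Type*} [CommRing S]
    (α : UnitalPartialAction G S) (l h k : G) (hk : l * h = k) (x : S)
    (h1 : x * α.E l⁻¹ = x) (h2 : x * α.E h = x) : α.act l x * α.E k = α.act l x := by
  subst hk
  have : α.act l x ∈ α.act l '' {x | x * α.E l⁻¹ = x ∧ x * α.E h = x} := ⟨x, ⟨h1, h2⟩, rfl⟩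
  rw [α.image_eq] at this
  exact this.2

theorem hat_mapsTo {G : Type*} [CommGroup G] {S : Type*} [CommRing S]
    (α : UnitalPartialAction G S) (l t l' t' m s : G) (hm : l * l' = m) (hs : t * t' = s)
    (x : G → S) (hx : x ∈ PdomA α l⁻¹ t⁻¹) (hx' : x ∈ PdomA α l' t') :
    hatActA α l t x ∈ PdomA α l t ∧ hatActA α l t x ∈ PdomA α m s := by
  subst hm hs
  simp only [mem_PdomA_iff] at *
  simp only [hatActA]
  have A : ∀ g, α.act l (x ((l * t)⁻¹ * g)) * α.E g = α.act l (x ((l * t)⁻¹ * g)) := fun g =>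
    act_mem_aux α l _ _ (by rw [inv_inv, ← mul_assoc, mul_inv_cancel_left]) _ (hx _).2.1 (hx ((l * t)⁻¹ * g)).2.2
  refine ⟨fun g => ⟨A g, α.mapsTo l _ (hx _).2.1, ?_⟩, fun g => ⟨A g, ?_, ?_⟩⟩
  · exact act_mem_aux α l _ _ (by rw [mul_inv, mul_assoc, mul_inv_cancel_left]) _ (hx _).2.1
      (hx ((l * t)⁻¹ * g)).1
  · exact act_mem_aux α l _ _ rfl _ (hx _).2.1 (hx' ((l * t)⁻¹ * g)).2.1
  · exact act_mem_aux α l _ _ (by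
      rw [mul_left_comm, mul_inv l t, mul_assoc l⁻¹, mul_inv_cancel_left, mul_inv t t', mul_comm t⁻¹ t'⁻¹,
        mul_assoc]) _ (hx _).2.1
      (hx' ((l * t)⁻¹ * g)).2.2

theorem hat_left_inv {G : Type*} [CommGroup G] {S : Type*} [CommRing S]
    (α : UnitalPartialAction G S) (l t : G)
    (x : G → S) (hx : x ∈ PdomA α l⁻¹ t⁻¹) :
    hatActA α l⁻¹ t⁻¹ (hatActA α l t x) = x := by
  rw [mem_PdomA_iff] at hx
  funext g
  have e : (l * t)⁻¹ * ((l⁻¹ * t⁻¹)⁻¹ * g) = g := by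
    rw [mul_inv l⁻¹, inv_inv, inv_inv, inv_mul_cancel_left]
  simp only [hatActA]
  rw [e]
  exact α.act_inv_act l _ (hx g).2.1

theorem hat_image {G : Type*} [CommGroup G] {S : Type*} [CommRing S]
    (α : UnitalPartialAction G S) (l t l' t' : G) :
    hatActA α l t '' (PdomA α l⁻¹ t⁻¹ ∩ PdomA α l' t') =
        PdomA α l t ∩ PdomA α (l * l') (t * t') := by
  apply Set.Subset.antisymm
  · rintro _ ⟨x, ⟨h1, h2⟩, rfl⟩
    exact hat_mapsTo α l t l' t' _ _ rfl rfl x h1 h2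
  · rintro y ⟨h1, h2⟩
    have h1' : y ∈ PdomA α l⁻¹⁻¹ t⁻¹⁻¹ := by simpa using h1
    refine ⟨hatActA α l⁻¹ t⁻¹ y, hat_mapsTo α l⁻¹ t⁻¹ (l * l') (t * t') l' t' (by simp) (by simp)
      y h1' h2, ?_⟩
    have := hat_left_inv α l⁻¹ t⁻¹ y h1'
    rwa [inv_inv, inv_inv] at this

/-- `α̂ = (P_{(l,t)}, α̂_{(l,t)})_{(l,t)∈G×G}` is a unital partial action of
`G×G` on `P = ∏_{g∈G} S_g`: each `α̂_{(l,t)}` is a well-defined ring isomorphism of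
`P_{(l⁻¹,t⁻¹)}` onto `P_{(l,t)}`, `α̂_{(1,1)} = id_P`, condition (P3) and condition (P4)
hold. -/
theorem hat_partial_action {G : Type*} [CommGroup G] [Fintype G]
    {S : Type*} [CommRing S] (α : UnitalPartialAction G S) :
    -- each α̂_{(l,t)} is a well-defined ring isomorphism from P_{(l⁻¹,t⁻¹)} onto P_{(l,t)}
    (∀ l t : G, Set.BijOn (hatActA α l t) (PdomA α l⁻¹ t⁻¹) (PdomA α l t)) ∧
    (∀ l t : G, ∀ x ∈ PdomA α l⁻¹ t⁻¹, ∀ y ∈ PdomA α l⁻¹ t⁻¹,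
      hatActA α l t (x + y) = hatActA α l t x + hatActA α l t y ∧
      hatActA α l t (x * y) = hatActA α l t x * hatActA α l t y) ∧
    -- α̂_{(1,1)} is the identity of P
    (∀ x ∈ PsetA α, hatActA α 1 1 x = x) ∧
    -- (P3)
    (∀ l t l' t' : G,
      hatActA α l t '' (PdomA α l⁻¹ t⁻¹ ∩ PdomA α l' t') =
        PdomA α l t ∩ PdomA α (l * l') (t * t')) ∧
    -- (P4)
    (∀ l t l' t' : G, ∀ x ∈ PdomA α l'⁻¹ t'⁻¹ ∩ PdomA α (l * l')⁻¹ (t * t')⁻¹,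
      hatActA α l t (hatActA α l' t' x) = hatActA α (l * l') (t * t') x) := by
  refine ⟨fun l t => ⟨fun x hx => ?_, fun x hx y hy h => ?_, fun y hy => ?_⟩, ?_, ?_, hat_image α, ?_⟩
  · exact (hat_mapsTo α l t _ _ _ _ rfl rfl x hx hx).1
  · rw [← hat_left_inv α l t x hx, h, hat_left_inv α l t y hy]
  · have := hat_image α l t l⁻¹ t⁻¹
    have hy1 : y ∈ PdomA α (l * l⁻¹) (t * t⁻¹) := by
      rw [mem_PdomA_iff] at hy ⊢
      intro g
      simp [α.E_one, (hy g).1]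
    obtain ⟨x, hx, rfl⟩ : y ∈ hatActA α l t '' (PdomA α l⁻¹ t⁻¹ ∩ PdomA α l⁻¹ t⁻¹) := by
      rw [this]; exact ⟨hy, hy1⟩
    exact ⟨x, hx.1, rfl⟩
  · intro l t x hx y hy
    rw [mem_PdomA_iff] at hx hy
    exact ⟨funext fun g => α.map_add l _ _ (hx _).2.1 (hy _).2.1,
      funext fun g => α.map_mul l _ _ (hx _).2.1 (hy _).2.1⟩
  · intro x _
    funext g
    simp [hatActA, α.act_one]
  · rintro l t l' t' x ⟨h1, h2⟩
    rw [mem_PdomA_iff] at h1 h2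
    funext g
    have e : (l' * t')⁻¹ * ((l * t)⁻¹ * g) = (l * l' * (t * t'))⁻¹ * g := by
      rw [← mul_assoc, ← mul_inv, mul_mul_mul_comm, mul_comm l' l, mul_comm t' t]
    simp only [hatActA]
    rw [e]
    exact α.act_act l l' _ (h1 _).2.1 (h2 _).2.1
end

section
/- Let G be a finite abelian group, α a unital partial action of G on the commutative ring S with R = S^α, and suppose S is an α-partial Galois extension of R. Then the R-algebra map φ : S ⊗_R S → ∏_{g∈G} S_g determined by φ(x ⊗ y) = (x·α_g(y·1_{g⁻¹}))_{g∈G} is a ring isomorphism, and for all (l,t) ∈ G×G it satisfies φ(S_l ⊗_R S_{t⁻¹}) = P_{(l,t)} and φ((α_l ⊗ α_{t⁻¹})(u)) = α̂_{(l,t)}(φ(u)) for every u ∈ S_{l⁻¹} ⊗_R S_t. Hence φ is a partial (G×G)-isomorphism from (S ⊗_R S, α ⊗ α*) onto (∏_{g∈G} S_g, α̂), where α* denotes the partial action of G on S with domains S*_g = S_{g⁻¹} and maps α*_g = α_{g⁻¹}. -/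
open Finset

namespace UnitalPartialAction

variable {G : Type*} [Group G] {S : Type*} [CommRing S] (α : UnitalPartialAction G S)

/-- The everywhere defined map `s ↦ α_g(s 1_{g⁻¹})`. -/
def bt (g : G) (s : S) : S := α.act g (s * α.E g⁻¹)

lemma dom (g : G) (s : S) : s * α.E g * α.E g = s * α.E g := by
  rw [mul_assoc, α.idem]

lemma bt_add (g : G) (x y : S) : α.bt g (x + y) = α.bt g x + α.bt g y := by
  unfold bt
  rw [add_mul, α.map_add _ _ _ (α.dom _ _) (α.dom _ _)]

lemma bt_mul (g : G) (x y : S) : α.bt g (x * y) = α.bt g x * α.bt g y := by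
  unfold bt
  rw [← α.map_mul _ _ _ (α.dom _ _) (α.dom _ _)]
  congr 1
  linear_combination -(x * y) * α.idem g⁻¹

lemma bt_E (g : G) (x : S) : α.bt g x * α.E g = α.bt g x :=
  α.mapsTo _ _ (α.dom _ _)

lemma bt_one (x : S) : α.bt 1 x = x := by
  simp [bt, α.E_one, α.act_one]

lemma bt_zero (g : G) : α.bt g 0 = 0 := by
  have h := α.bt_add g 0 0
  rw [add_zero] at h
  exact left_eq_add.mp h

lemma bt_sum {ι : Type*} (s : Finset ι) (g : G) (f : ι → S) :
    α.bt g (∑ i ∈ s, f i) = ∑ i ∈ s, α.bt g (f i) := by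
  classical
  induction s using Finset.induction_on with
  | empty => simp [bt_zero]
  | insert a s ha ih => rw [Finset.sum_insert ha, Finset.sum_insert ha, bt_add, ih]

lemma bt_of_dom (g : G) (x : S) (h : x * α.E g⁻¹ = x) : α.bt g x = α.act g x := by
  rw [bt, h]

lemma bt_E_eq (g k : G) : α.bt g (α.E k) = α.E g * α.E (g * k) := by
  have h1 : α.E g * α.E (g * k) ∈ α.act g '' {x | x * α.E g⁻¹ = x ∧ x * α.E k = x} := by
    rw [α.image_eq]
    constructor
    · linear_combination α.E (g * k) * α.idem g
    · linear_combination α.E g * α.idem (g * k)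
  obtain ⟨z, ⟨hz1, hz2⟩, hz⟩ := h1
  have h2 : α.act g (α.E k * α.E g⁻¹) ∈
      α.act g '' {x | x * α.E g⁻¹ = x ∧ x * α.E k = x} := by
    refine ⟨_, ⟨?_, ?_⟩, rfl⟩
    · exact α.dom _ _
    · linear_combination α.E g⁻¹ * α.idem k
  rw [α.image_eq] at h2
  obtain ⟨h3, h4⟩ := h2
  have h5 := α.map_mul g (α.E k * α.E g⁻¹) z (α.dom _ _) hz1
  have h6 : α.E k * α.E g⁻¹ * z = z := by
    linear_combination α.E k * hz1 + hz2
  rw [h6, hz] at h5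
  unfold bt
  rw [h5]
  rw [← mul_assoc, h3, h4]

lemma bt_unit (g : G) : α.bt g 1 = α.E g := by
  rw [← α.E_one, bt_E_eq, mul_one, α.idem]

lemma bt_bt (g k : G) (y : S) : α.bt g (α.bt k y) = α.E g * α.bt (g * k) y := by
  have e1 : α.bt k y * α.E g⁻¹ = α.bt k (y * α.E (g * k)⁻¹) := by
    rw [bt_mul, bt_E_eq, mul_inv_rev, mul_inv_cancel_left]
    linear_combination - α.E g⁻¹ * α.bt_E k y
  have e2 : α.bt g (α.bt k y) = α.act g (α.act k (y * α.E (g * k)⁻¹ * α.E k⁻¹)) := by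
    conv_lhs => rw [bt]
    rw [e1, bt]
  rw [e2, α.act_act _ _ _ (α.dom _ _)
    (by linear_combination (y * α.E k⁻¹) * α.idem (g * k)⁻¹)]
  have e3 : y * α.E (g * k)⁻¹ * α.E k⁻¹ = y * α.E k⁻¹ * α.E (g * k)⁻¹ := by ring
  rw [e3]
  change α.bt (g * k) (y * α.E k⁻¹) = _
  rw [bt_mul, bt_E_eq, mul_inv_cancel_right]
  linear_combination α.E g * α.bt_E (g * k) y

end UnitalPartialAction

/-- if `S` is an `α`-partial Galois extension of `R = S^α`, then the
`R`-algebra map `φ : S ⊗_R S → ∏_{g∈G} S_g`, `φ(x ⊗ y) = (x·α_g(y·1_{g⁻¹}))_{g∈G}`,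
is a ring isomorphism onto `P = ∏_{g∈G} S_g`, carries `S_l ⊗_R S_{t⁻¹}` onto `P_{(l,t)}`
and intertwines `α_l ⊗ α_{t⁻¹}` with `α̂_{(l,t)}`; i.e. it is a partial
`(G×G)`-isomorphism from `(S ⊗_R S, α ⊗ α*)` onto `(∏_{g∈G} S_g, α̂)`. -/
theorem tensor_iso_product {G : Type*} [CommGroup G] [Fintype G]
    {R S : Type*} [CommRing R] [CommRing S] [Algebra R S]
    (hRinj : Function.Injective (algebraMap R S))
    (α : UnitalPartialAction G S)
    (hinv : α.invariants = Set.range (algebraMap R S))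
    (hGal : α.IsPartialGalois) :
    ∃ φ : TensorProduct R S S → (G → S),
      -- φ is an R-algebra map determined by φ(x ⊗ y) = (x·α_g(y·1_{g⁻¹}))_g
      (∀ a b : TensorProduct R S S, φ (a + b) = φ a + φ b) ∧
      (∀ a b : TensorProduct R S S, φ (a * b) = φ a * φ b) ∧
      (∀ (r : R) (a : TensorProduct R S S), φ (r • a) = r • φ a) ∧
      (∀ x y : S, φ (TensorProduct.tmul R x y) =
        fun g : G => x * α.act g (y * α.E g⁻¹)) ∧
      -- φ is a ring isomorphism onto P = ∏_{g∈G} S_g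
      Function.Injective φ ∧ Set.range φ = PsetA α ∧
      -- φ(S_l ⊗_R S_{t⁻¹}) = P_{(l,t)}
      (∀ l t : G,
        φ '' (Submodule.span R {z : TensorProduct R S S |
          ∃ x y : S, x * α.E l = x ∧ y * α.E t⁻¹ = y ∧
            z = TensorProduct.tmul R x y} : Set (TensorProduct R S S)) = PdomA α l t) ∧
      -- φ ∘ (α_l ⊗ α_{t⁻¹}) = α̂_{(l,t)} ∘ φ on S_{l⁻¹} ⊗_R S_t
      (∀ l t : G, ∀ x y : S, x * α.E l⁻¹ = x → y * α.E t = y →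
        φ (TensorProduct.tmul R (α.act l x) (α.act t⁻¹ y)) =
          hatActA α l t (φ (TensorProduct.tmul R x y))) := by
  classical
  have hR : ∀ (g : G) (r : R), α.bt g (algebraMap R S r) = algebraMap R S r * α.E g := by
    intro g r
    have : algebraMap R S r ∈ α.invariants := by rw [hinv]; exact ⟨r, rfl⟩
    exact this g
  let B : G → (S →ₗ[R] S) := fun g =>
    { toFun := α.bt g
      map_add' := α.bt_add g
      map_smul' := by
        intro r x
        rw [Algebra.smul_def, α.bt_mul, hR, RingHom.id_apply, Algebra.smul_def, mul_assoc,
          mul_comm (α.E g), α.bt_E] }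
  let Φ : TensorProduct R S S →ₗ[R] (G → S) :=
    LinearMap.pi fun g => (LinearMap.mul' R S).comp (TensorProduct.map LinearMap.id (B g))
  have hΦ : ∀ x y g, Φ (TensorProduct.tmul R x y) g = x * α.bt g y := by
    intro x y g
    rfl
  have hmul : ∀ a b, Φ (a * b) = Φ a * Φ b := by
    intro a b
    induction a using TensorProduct.induction_on with
    | zero => simp
    | add a a' h h' => rw [add_mul, map_add, h, h', map_add, add_mul]
    | tmul x y =>
      induction b using TensorProduct.induction_on with
      | zero => simp
      | add a a' h h' => rw [mul_add, map_add, h, h', map_add, mul_add]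
      | tmul x' y' =>
        funext g
        rw [Algebra.TensorProduct.tmul_mul_tmul, Pi.mul_apply, hΦ, hΦ, hΦ, α.bt_mul]
        ring
  obtain ⟨n, x, y, hg1, hgn⟩ := hGal
  have hxy : ∀ g, ∑ i, x i * α.bt g (y i) = if g = 1 then 1 else 0 := by
    intro g
    split_ifs with h
    · exact hg1 g h
    · exact hgn g h
  have hxy2 : ∀ h g, ∑ i, α.bt h (x i) * α.bt g (y i) = if g = h then α.E h else 0 := by
    intro h g
    have e := congrArg (α.bt h) (hxy (h⁻¹ * g))
    rw [α.bt_sum] at e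
    have e2 : ∀ i, α.bt h (x i * α.bt (h⁻¹ * g) (y i)) = α.bt h (x i) * α.bt g (y i) := by
      intro i
      rw [α.bt_mul, α.bt_bt, mul_inv_cancel_left, ← mul_assoc, α.bt_E]
    simp only [e2] at e
    rw [e]
    by_cases hh : g = h
    · subst hh
      simp [α.bt_unit]
    · have : h⁻¹ * g ≠ 1 := by
        intro hc
        exact hh (inv_mul_eq_one.mp hc).symm
      simp [this, hh, α.bt_zero]
  -- the inverse
  let Ψ : (G → S) →ₗ[R] TensorProduct R S S :=
    ∑ h, ∑ i, (((TensorProduct.mk R S S).flip (y i)).comp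
      (LinearMap.mulLeft R (α.bt h (x i)))).comp (LinearMap.proj h)
  have hΨ : ∀ v, Ψ v = ∑ h, ∑ i, TensorProduct.tmul R (α.bt h (x i) * v h) (y i) := by
    intro v
    simp [Ψ, LinearMap.sum_apply]
  have hΦΨ : ∀ v ∈ PsetA α, Φ (Ψ v) = v := by
    intro v hv
    funext g
    rw [hΨ]
    simp only [map_sum, Finset.sum_apply, hΦ]
    have : ∀ h, ∑ i, α.bt h (x i) * v h * α.bt g (y i) = if g = h then v h else 0 := by
      intro h
      have e : ∑ i, α.bt h (x i) * v h * α.bt g (y i)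
          = v h * ∑ i, α.bt h (x i) * α.bt g (y i) := by
        rw [Finset.mul_sum]
        exact Finset.sum_congr rfl fun i _ => by ring
      rw [e, hxy2]
      split_ifs
      · exact hv h
      · simp
    simp [this]
  have htr : ∀ s : S, ∃ r : R, algebraMap R S r = ∑ h, α.bt h s := by
    intro s
    have : (∑ h, α.bt h s) ∈ α.invariants := by
      intro g
      change α.bt g _ = _
      rw [α.bt_sum]
      simp only [α.bt_bt]
      rw [← Finset.mul_sum, mul_comm]
      congr 1
      exact Fintype.sum_equiv (Equiv.mulLeft g) _ _ fun _ => rfl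
    rw [hinv] at this
    exact this
  choose tr htr using htr
  have hΨΦ : ∀ a, Ψ (Φ a) = a := by
    intro a
    induction a using TensorProduct.induction_on with
    | zero => simp
    | add a b ha hb => rw [map_add, map_add, ha, hb]
    | tmul s t =>
      rw [hΨ, Finset.sum_comm]
      have e1 : ∀ i, ∑ h, TensorProduct.tmul R (α.bt h (x i) * Φ (TensorProduct.tmul R s t) h) (y i)
          = TensorProduct.tmul R s (tr (t * x i) • y i) := by
        intro i
        rw [← TensorProduct.sum_tmul, ← TensorProduct.smul_tmul, Algebra.smul_def, htr,
          Finset.sum_mul]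
        congr 1
        refine Finset.sum_congr rfl fun h _ => ?_
        rw [hΦ, α.bt_mul]
        ring
      simp only [e1]
      rw [← TensorProduct.tmul_sum]
      congr 1
      simp only [Algebra.smul_def, htr, Finset.sum_mul]
      rw [Finset.sum_comm]
      have e2 : ∀ h, ∑ i, α.bt h (t * x i) * y i = if 1 = h then t else 0 := by
        intro h
        have e := hxy2 h 1
        simp only [α.bt_one] at e
        have e3 : ∑ i, α.bt h (t * x i) * y i = α.bt h t * ∑ i, α.bt h (x i) * y i := by
          rw [Finset.mul_sum]
          exact Finset.sum_congr rfl fun i _ => by rw [α.bt_mul]; ring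
        rw [e3, e]
        split_ifs with hh
        · subst hh
          rw [α.bt_E, α.bt_one]
        · simp
      simp [e2]
  have hmem : ∀ a, Φ a ∈ PsetA α := by
    intro a g
    induction a using TensorProduct.induction_on with
    | zero => simp
    | add a b ha hb => rw [map_add, Pi.add_apply, add_mul, ha, hb]
    | tmul s t => rw [hΦ, mul_assoc, α.bt_E]
  refine ⟨Φ, map_add Φ, hmul, map_smul Φ, fun x y => rfl, ?_, ?_, ?_, ?_⟩
  · exact Function.LeftInverse.injective hΨΦ
  · ext v
    constructor
    · rintro ⟨a, rfl⟩
      exact hmem a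
    · intro hv
      exact ⟨_, hΦΨ v hv⟩
  · intro l t
    ext v
    constructor
    · rintro ⟨a, ha, rfl⟩ g
      induction ha using Submodule.span_induction with
      | zero => simp
      | add a b _ _ ha hb => rw [map_add, Pi.add_apply, add_mul, ha, hb]
      | smul r a _ ha => rw [map_smul, Pi.smul_apply, smul_mul_assoc, ha]
      | mem a ha =>
        obtain ⟨p, q, hp, hq, rfl⟩ := ha
        rw [hΦ]
        have e : α.bt g q = α.bt g q * α.E (t⁻¹ * g) := by
          conv_lhs => rw [← hq, α.bt_mul, α.bt_E_eq, ← mul_assoc, α.bt_E, mul_comm g]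
        have e2 := α.bt_E g q
        calc p * α.bt g q * (α.E g * α.E l * α.E (t⁻¹ * g))
            = (p * α.E l) * (α.bt g q * α.E g * α.E (t⁻¹ * g)) := by ring
          _ = _ := by rw [hp, e2, ← e]
    · intro hv
      have hvP : v ∈ PsetA α := by
        intro g
        have := hv g
        have h2 := α.idem g
        linear_combination (1 - α.E g) * this + v g * α.E l * α.E (t⁻¹ * g) * h2
      refine ⟨Ψ v * TensorProduct.tmul R (α.E l) (α.E t⁻¹), ?_, ?_⟩
      · generalize Ψ v = a
        induction a using TensorProduct.induction_on with
        | zero => simp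
        | add a b ha hb => rw [add_mul]; exact Submodule.add_mem _ ha hb
        | tmul p q =>
          rw [Algebra.TensorProduct.tmul_mul_tmul]
          exact Submodule.subset_span ⟨_, _, α.dom _ _, α.dom _ _, rfl⟩
      · rw [hmul, hΦΨ v hvP]
        funext g
        rw [Pi.mul_apply, hΦ, α.bt_E_eq, mul_comm g]
        have := hv g
        linear_combination this
  · intro l t p q hp hq
    funext g
    have hq' : q * α.E (t⁻¹)⁻¹ = q := by rwa [inv_inv]
    rw [hatActA, hΦ, hΦ, ← α.bt_of_dom l p hp, ← α.bt_of_dom _ q hq',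
      ← α.bt_of_dom l _ (by linear_combination α.bt ((l * t)⁻¹ * g) q * hp),
      α.bt_mul, α.bt_bt, α.bt_bt]
    have e0 : l * ((l * t)⁻¹ * g) = g * t⁻¹ := by
      rw [mul_inv_rev, mul_comm g]
      rw [mul_comm t⁻¹ l⁻¹, mul_assoc, mul_inv_cancel_left]
    rw [e0]
    have e1 : α.bt (g * t⁻¹) q = α.bt (g * t⁻¹) q * α.E g := by
      conv_lhs => rw [← hq, α.bt_mul, α.bt_E_eq, ← mul_assoc, α.bt_E, inv_mul_cancel_right]
    rw [← mul_assoc (α.bt l p) (α.E l), α.bt_E, mul_comm (α.E g), ← e1]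
end

section
/- Let G be a finite abelian group and α a unital partial action of G on the commutative ring S, and let δG = {(l, l⁻¹) : l ∈ G} be the diagonal-type subgroup of G×G. Then the subring of invariants of P = ∏_{g∈G} S_g under the restriction of α̂ to δG equals E(S,α) := {(d_g)_{g∈G} ∈ ∏_{g∈G} S_g : α_l(d_g·1_{l⁻¹})·1_g = d_g·1_l·1_{lg} for all l, g ∈ G}; that is, a tuple (d_g)_{g∈G} ∈ P satisfies α̂_{(l,l⁻¹)}((d_g·1_{l⁻¹}·1_{l⁻¹g})_{g∈G}) = (d_g·1_l·1_{lg})_{g∈G} for every l ∈ G exactly when it lies in E(S,α). -/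
open Finset

theorem UnitalPartialAction.act_mul_E {G : Type*} [Group G] {S : Type*} [CommRing S]
    (α : UnitalPartialAction G S) (l g : G) (x : S) :
    α.act l (x * α.E l⁻¹ * α.E (l⁻¹ * g)) = α.act l (x * α.E l⁻¹) * α.E g := by
  have hl := α.idem l
  have hg := α.idem g
  have hi := α.idem l⁻¹
  have hk := α.idem (l⁻¹ * g)
  have him := α.image_eq l (l⁻¹ * g)
  rw [mul_inv_cancel_left] at him
  have he1 : (α.E l⁻¹ * α.E (l⁻¹ * g)) * α.E l⁻¹ = α.E l⁻¹ * α.E (l⁻¹ * g) := by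
    rw [mul_right_comm, hi]
  have he2 : (α.E l⁻¹ * α.E (l⁻¹ * g)) * α.E (l⁻¹ * g) = α.E l⁻¹ * α.E (l⁻¹ * g) := by
    rw [mul_assoc, hk]
  have hu : α.act l (α.E l⁻¹ * α.E (l⁻¹ * g)) ∈ {x | x * α.E l = x ∧ x * α.E g = x} := by
    rw [← him]
    exact ⟨_, ⟨he1, he2⟩, rfl⟩
  have hv : α.E l * α.E g ∈ {x | x * α.E l = x ∧ x * α.E g = x} :=
    ⟨by rw [mul_right_comm, hl], by rw [mul_assoc, hg]⟩
  rw [← him] at hv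
  obtain ⟨y, ⟨hy1, hy2⟩, hy⟩ := hv
  obtain ⟨hu1, hu2⟩ := hu
  have h1 := α.map_mul l y _ hy1 he1
  rw [← mul_assoc, hy1, hy2, hy] at h1
  have hunit : α.act l (α.E l⁻¹ * α.E (l⁻¹ * g)) = α.E l * α.E g := by
    linear_combination (-1 : S) * h1 - α.E g * hu1 - hu2
  have hx : x * α.E l⁻¹ * α.E l⁻¹ = x * α.E l⁻¹ := by rw [mul_assoc, hi]
  have h2 := α.map_mul l _ _ hx he1
  have h3 := α.mapsTo l _ hx
  rw [← mul_assoc, hx, hunit, ← mul_assoc, h3] at h2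
  exact h2

/-- the subring of invariants of `P = ∏_{g∈G} S_g` under the restriction
of `α̂` to the diagonal-type subgroup `δG = {(l, l⁻¹) : l ∈ G}` equals
`E(S,α) = {(d_g)_g ∈ ∏_g S_g : α_l(d_g·1_{l⁻¹})·1_g = d_g·1_l·1_{lg} for all l, g}`. -/
theorem invariants_deltaG {G : Type*} [CommGroup G] [Fintype G]
    {S : Type*} [CommRing S] (α : UnitalPartialAction G S) :
    {x : G → S | x ∈ PsetA α ∧
        ∀ l : G, hatActA α l l⁻¹ (fun g => x g * α.E l⁻¹ * α.E (l⁻¹ * g)) =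
          fun g => x g * α.E l * α.E (l * g)} =
      {x : G → S | x ∈ PsetA α ∧
        ∀ l g : G, α.act l (x g * α.E l⁻¹) * α.E g = x g * α.E l * α.E (l * g)} := by
  ext x
  simp only [Set.mem_setOf_eq, hatActA, funext_iff, mul_inv_cancel, inv_one, one_mul,
    α.act_mul_E]
end

section
/- Assume H is normal in G. Then there exist x_1, …, x_n, y_1, …, y_n ∈ T^H·e_H such that for every g ∈ G, Σ_{i=1}^{n} x_i·γ_{gH}(y_i·e_H·β_{g⁻¹}(e_H)) equals e_H if g ∈ H and 0 otherwise (i.e. T^H·e_H is a partial Galois extension of its invariants (T^H·e_H)^{γ_{G/H}} with group G/H, where γ_{gH} denotes the restriction of β_g to the ideal T^H·e_H·β_{g⁻¹}(e_H)), if and only if there exist u_1, …, u_r, v_1, …, v_r ∈ T^H such that for every g ∈ G, Σ_{j=1}^{r} u_j·β_g(v_j) equals 1_T if g ∈ H and 0 otherwise (i.e. T^H is a G/H-Galois extension of T^G). -/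
open Finset

variable {T : Type*} [CommRing T] {G : Type*} [Group G]

theorem psiH_one_eq {T : Type*} [CommRing T] {G : Type*} [Group G] [Fintype G]
    (β : G →* RingAut T) (oneS : T) (honeS : oneS * oneS = oneS)
    (H : Subgroup G) {m : ℕ} (h : Fin (m + 1) → G)
    (hinj : Function.Injective h) (hrange : Set.range h = (H : Set G)) :
    by classical exact psiH β oneS h oneS
      = 1 - ∏ g ∈ Finset.univ.filter (fun g => g ∈ H), (1 - β g oneS) := by
  classical
  have him : Finset.univ.filter (fun g => g ∈ H) = Finset.univ.image h := by
    ext g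
    have : g ∈ Set.range h ↔ g ∈ (H : Set G) := by rw [hrange]
    simpa using this.symm
  rw [him, Finset.prod_image (fun a _ b _ hab => hinj hab), Finset.prod_one_sub_ordered,
    sub_sub_cancel]
  unfold psiH eIdem
  refine Finset.sum_congr rfl fun i _ => ?_
  have : β (h i) oneS * β (h i) oneS = β (h i) oneS := by rw [← map_mul, honeS]
  rw [mul_left_comm, this, mul_comm]

theorem exists_coeff {T : Type*} [CommRing T] {G : Type*} [Group G]
    (β : G →* RingAut T) (H : Subgroup G) (b : G → T) (hb : ∀ g, b g ∈ TFix β H)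
    (s : Finset G) :
    ∃ c : G → T, (∀ g, c g ∈ TFix β H) ∧
      1 - ∏ g ∈ s, (1 - b g) = ∑ g ∈ s, c g * b g := by
  classical
  induction s using Finset.induction_on with
  | empty => exact ⟨fun _ => 1, fun g k _ => map_one _, by simp⟩
  | insert a s ha ih =>
    obtain ⟨c, hc, hs⟩ := ih
    refine ⟨fun g => if g = a then 1 else c g * (1 - b a), ?_, ?_⟩
    · intro g k hk
      by_cases hg : g = a
      · simp [hg]
      · simp only [hg, if_false, map_mul, map_sub, map_one, hc g k hk, hb a k hk]
    · rw [Finset.prod_insert ha, Finset.sum_insert ha]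
      have : ∑ g ∈ s, (if g = a then 1 else c g * (1 - b a)) * b g
          = (1 - b a) * ∑ g ∈ s, c g * b g := by
        rw [Finset.mul_sum]
        refine Finset.sum_congr rfl fun g hg => ?_
        have : g ≠ a := fun h => ha (h ▸ hg)
        simp only [this, if_false]
        ring
      rw [this, ← hs]
      simp only [if_true]
      ring

/-- for `H` normal in `G`, the ideal `T^H·e_H` is a partial Galois
extension of its invariants `(T^H·e_H)^{γ_{G/H}}` with group `G/H`
(where `γ_{gH}` is the restriction of `β_g` to `T^H·e_H·β_{g⁻¹}(e_H)`)
if and only if `T^H` is a `G/H`-Galois extension of `T^G`. -/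
theorem partialGalois_ideal_iff_global {T : Type*} [CommRing T] {G : Type*} [Group G]
    [Fintype G]
    (β : G →* RingAut T) (oneS : T) (honeS : oneS * oneS = oneS)
    (hglob : ∀ t : T, ∃ c : G → T, t = ∑ g : G, β g (c g * oneS))
    (H : Subgroup G) (hN : H.Normal) {m : ℕ} (h : Fin (m + 1) → G)
    (hinj : Function.Injective h) (hrange : Set.range h = (H : Set G))
    (h1 : h 0 = 1) :
    (∃ (n : ℕ) (x y : Fin n → T),
      (∀ i, (∃ t ∈ TFix β H, x i = t * psiH β oneS h oneS) ∧
            (∃ t ∈ TFix β H, y i = t * psiH β oneS h oneS)) ∧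
      (∀ g ∈ H, ∑ i, x i * β g (y i * psiH β oneS h oneS * β g⁻¹ (psiH β oneS h oneS)) =
        psiH β oneS h oneS) ∧
      (∀ g ∉ H, ∑ i, x i * β g (y i * psiH β oneS h oneS * β g⁻¹ (psiH β oneS h oneS)) =
        0)) ↔
    (∃ (r : ℕ) (u v : Fin r → T),
      (∀ j, u j ∈ TFix β H ∧ v j ∈ TFix β H) ∧
      (∀ g ∈ H, ∑ j, u j * β g (v j) = 1) ∧
      (∀ g ∉ H, ∑ j, u j * β g (v j) = 0)) := by
  classical
  obtain ⟨e, he⟩ : ∃ e, e = psiH β oneS h oneS := ⟨_, rfl⟩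
  have hform := psiH_one_eq β oneS honeS H h hinj hrange
  rw [← he] at hform ⊢
  have hmul : ∀ a b t, β a (β b t) = β (a * b) t := fun a b t => by
    rw [map_mul]; rfl
  have hidem : ∀ g, β g oneS * β g oneS = β g oneS := fun g => by rw [← map_mul, honeS]
  have heH : e ∈ TFix β H := by
    intro k hk
    rw [hform, map_sub, map_one, map_prod]
    congr 1
    refine Finset.prod_equiv (Equiv.mulLeft k) (fun g => ?_) (fun g _ => ?_)
    · simp [H.mul_mem_cancel_left hk]
    · rw [map_sub, map_one, hmul]; rfl
  have heS : (1 - e) * oneS = 0 := by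
    rw [hform, sub_sub_cancel, ← Finset.mul_prod_erase _ _ (a := (1 : G)) (by simp)]
    simp only [map_one, RingAut.one_apply]
    linear_combination (-∏ x ∈ (Finset.univ.filter (fun g => g ∈ H)).erase 1, (1 - β x oneS)) * honeS
  have hee : e * e = e := by
    have key : ∀ k ∈ H, (1 - e) * β k oneS = 0 := fun k hk => by
      have := congrArg (β k) heS
      rwa [map_mul, map_sub, map_one, heH k hk, map_zero] at this
    have : (1 - e) * e = 0 := by
      have he2 : e = ∑ i, β (h i) oneS * eIdem β oneS h i := he
      conv_lhs => arg 2; rw [he2]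
      rw [Finset.mul_sum]
      refine Finset.sum_eq_zero fun i _ => ?_
      have hi : h i ∈ H := by
        have : h i ∈ (H : Set G) := hrange ▸ Set.mem_range_self i
        exact this
      rw [← mul_assoc, key _ hi, zero_mul]
    linear_combination -this
  constructor
  · rintro ⟨n, x, y, hxy, hin, hout⟩
    have hgen : ∀ g, ∑ i, x i * β g (y i * e * β g⁻¹ e) = ∑ i, x i * β g (y i) := by
      intro g
      refine Finset.sum_congr rfl fun i _ => ?_
      obtain ⟨⟨t, _, ht⟩, ⟨t', _, ht'⟩⟩ := hxy i
      have h1 : x i * e = x i := by rw [ht, mul_assoc, hee]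
      have h2 : y i * e = y i := by rw [ht', mul_assoc, hee]
      rw [h2, map_mul, hmul, mul_inv_cancel, map_one, RingAut.one_apply]
      linear_combination β g (y i) * h1
    simp only [hgen] at hin hout
    have hfix : ∀ g, ∀ t ∈ TFix β H, β g t ∈ TFix β H := by
      intro g t ht k hk
      have : k * g = g * (g⁻¹ * k * g) := by group
      rw [hmul, this, ← hmul, ht _ (by simpa using hN.conj_mem k hk g⁻¹)]
    have hxF : ∀ i, x i ∈ TFix β H ∧ y i ∈ TFix β H := by
      intro i
      obtain ⟨⟨t, h1, ht⟩, ⟨t', h2, ht'⟩⟩ := hxy i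
      constructor
      · intro k hk; rw [ht, map_mul, h1 k hk, heH k hk]
      · intro k hk; rw [ht', map_mul, h2 k hk, heH k hk]
    obtain ⟨c, hc, hsum⟩ := exists_coeff β H (fun g => β g e) (fun g => hfix g e heH) Finset.univ
    have hzero : ∏ g : G, (1 - β g e) = 0 := by
      obtain ⟨d, hd⟩ := hglob 1
      have hP : ∀ P : T, P = (∑ g, β g (d g * oneS)) * P := fun P => by rw [← hd, one_mul]
      rw [hP (∏ g : G, (1 - β g e)), Finset.sum_mul]
      refine Finset.sum_eq_zero fun g _ => ?_
      rw [← Finset.mul_prod_erase _ _ (Finset.mem_univ g)]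
      have := congrArg (β g) heS
      rw [map_mul, map_sub, map_one, map_zero] at this
      rw [map_mul]
      linear_combination (β g (d g) * ∏ x ∈ Finset.univ.erase g, (1 - β x e)) * this
    rw [hzero, sub_zero] at hsum
    have hcomp : ∀ g, ∑ p : G × Fin n, c p.1 * β p.1 (x p.2) * β g (β p.1 (y p.2))
        = ∑ k, c k * β k (∑ i, x i * β (k⁻¹ * g * k) (y i)) := by
      intro g
      rw [Fintype.sum_prod_type]
      refine Finset.sum_congr rfl fun k _ => ?_
      rw [map_sum, Finset.mul_sum]
      refine Finset.sum_congr rfl fun i _ => ?_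
      have : k * (k⁻¹ * g * k) = g * k := by group
      rw [map_mul, hmul, hmul, this, mul_assoc]
    let E := Fintype.equivFin (G × Fin n)
    refine ⟨Fintype.card (G × Fin n), fun j => c (E.symm j).1 * β (E.symm j).1 (x (E.symm j).2),
      fun j => β (E.symm j).1 (y (E.symm j).2), ?_, ?_, ?_⟩
    · intro j
      refine ⟨?_, hfix _ _ (hxF _).2⟩
      intro k hk
      rw [map_mul, hc _ k hk, hfix _ _ (hxF _).1 k hk]
    · intro g hg
      rw [E.symm.sum_comp (fun p : G × Fin n => c p.1 * β p.1 (x p.2) * β g (β p.1 (y p.2))),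
        hcomp, hsum]
      refine Finset.sum_congr rfl fun k _ => ?_
      rw [hin _ (by simpa using hN.conj_mem g hg k⁻¹)]
    · intro g hg
      rw [E.symm.sum_comp (fun p : G × Fin n => c p.1 * β p.1 (x p.2) * β g (β p.1 (y p.2))),
        hcomp]
      refine Finset.sum_eq_zero fun k _ => ?_
      rw [hout, map_zero, mul_zero]
      intro hk
      apply hg
      have := hN.conj_mem _ hk k
      have h2 : k * (k⁻¹ * g * k) * k⁻¹ = g := by group
      rwa [h2] at this
  · rintro ⟨r, u, v, huv, hin, hout⟩
    have hgen : ∀ g, ∑ i, u i * e * β g (v i * e * e * β g⁻¹ e)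
        = (∑ i, u i * β g (v i)) * (e * β g e) := by
      intro g
      rw [Finset.sum_mul]
      refine Finset.sum_congr rfl fun i _ => ?_
      rw [mul_assoc (v i), hee, map_mul, map_mul, hmul, mul_inv_cancel, map_one,
        RingAut.one_apply]
      linear_combination (u i * β g (v i) * β g e) * hee
    refine ⟨r, fun i => u i * e, fun i => v i * e,
      fun i => ⟨⟨_, (huv i).1, rfl⟩, ⟨_, (huv i).2, rfl⟩⟩, ?_, ?_⟩
    · intro g hg
      rw [hgen, hin g hg, heH g hg, one_mul, hee]
    · intro g hg
      rw [hgen, hout g hg, zero_mul]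
end
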